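/- Let m, d ≥ 1 be integers and let ω ∈ ℝ^d satisfy ω·ν ≠ 0 for every nonzero ν ∈ ℤ^d. Let M and Γ be symmetric positive definite real m×m matrices. Let Ṽ : ℝ^m × ℝ^d → ℝ be real analytic and (2πℤ)^d-periodic in its second argument, let h(x, ψ) = ∂Ṽ/∂x (x, ψ), and let Ṽ₀(x) = (2π)^{−d} ∫_{[0,2π]^d} Ṽ(x, ψ) dψ. Suppose c ∈ ℝ^m satisfies ∇Ṽ₀(c) = 0 and the Hessian matrix of Ṽ₀ at c is positive definite. Then there exists ε₀ > 0 such that for every ε ∈ (0, ε₀) there is a real analytic, (2πℤ)^d-periodic function X_ε : ℝ^d → ℝ^m such that x(t) := c + X_ε(ωt) satisfies ε M x''(t) + Γ x'(t) + ε h(x(t), ωt) = 0 for all t ∈ ℝ; moreover sup_{ψ∈ℝ^d} |X_ε(ψ)| → 0 as ε → 0⁺. -/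

import Mathlib

open scoped Real
open Filter

noncomputable section

/-- The Hessian matrix of `V : ℝ^m → ℝ` at the point `c`. -/
def hessianMatrix (m : ℕ) (V : (Fin m → ℝ) → ℝ) (c : Fin m → ℝ) :
    Matrix (Fin m) (Fin m) ℝ :=
  Matrix.of fun i j => iteratedFDeriv ℝ 2 V c ![Pi.single i 1, Pi.single j 1]

/-- `(2πℤ)^d`-periodicity. -/
def IsPeriodic2pi (d m : ℕ) (F : (Fin d → ℝ) → (Fin m → ℝ)) : Prop :=
  ∀ (ψ : Fin d → ℝ) (k : Fin d → ℤ), F (fun j => ψ j + 2 * π * k j) = F ψ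

section Part1

/-- simultaneous diagonalisation of two positive definite forms -/
theorem simul_diag {m : ℕ} (Γ M : Matrix (Fin m) (Fin m) ℝ) (hΓ : Γ.PosDef) (hM : M.PosDef) :
    ∃ (P N : Matrix (Fin m) (Fin m) ℝ) (l : Fin m → ℝ), (∀ i, 0 < l i) ∧
      Γ * P = N ∧ M * P = N * Matrix.diagonal l ∧ N * P.transpose = 1 := by
  classical
  obtain ⟨B, hBu, hB⟩ : ∃ B : Matrix (Fin m) (Fin m) ℝ, IsUnit B ∧ Γ = B.transpose * B := by
    have h1 := hΓ.1.spectral_theorem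
    set U := (hΓ.1.eigenvectorUnitary : Matrix (Fin m) (Fin m) ℝ) with hU
    set e := hΓ.1.eigenvalues with he
    have hepos : ∀ i, 0 < e i := hΓ.eigenvalues_pos
    have hUU : U * star U = 1 := Unitary.coe_mul_star_self _
    have hUU' : star U * U = 1 := Unitary.coe_star_mul_self _
    have h2 : Γ = U * Matrix.diagonal e * star U := by
      rw [Unitary.conjStarAlgAut_apply] at h1
      simpa [Function.comp_def] using h1
    refine ⟨Matrix.diagonal (fun i => Real.sqrt (e i)) * star U, ?_, ?_⟩
    · refine IsUnit.mul ?_ (IsUnit.of_mul_eq_one _ hUU')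
      rw [Matrix.isUnit_iff_isUnit_det, Matrix.det_diagonal]
      exact (Finset.prod_ne_zero_iff.2 fun i _ => (Real.sqrt_pos.2 (hepos i)).ne').isUnit
    · rw [Matrix.transpose_mul, Matrix.diagonal_transpose]
      have : (star U).transpose = U := by
        rw [Matrix.star_eq_conjTranspose, Matrix.conjTranspose_eq_transpose_of_trivial,
          Matrix.transpose_transpose]
      rw [this]
      conv_lhs => rw [h2]
      have : Matrix.diagonal e = Matrix.diagonal (fun i => Real.sqrt (e i)) *
          Matrix.diagonal (fun i => Real.sqrt (e i)) := by
        rw [Matrix.diagonal_mul_diagonal]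
        congr 1; ext i
        exact (Real.mul_self_sqrt (hepos i).le).symm
      rw [this]; simp only [Matrix.mul_assoc]
  obtain ⟨C, hBC, hCB⟩ : ∃ C, B * C = 1 ∧ C * B = 1 := isUnit_iff_exists.1 hBu
  have hD : (C.transpose * M * C).PosDef := by
    have := hM.conjTranspose_mul_mul_same (B := C) (by
      intro x y hxy
      have := congrArg (fun v => B.mulVec v) hxy
      simpa [Matrix.mulVec_mulVec, hBC] using this)
    simpa using this
  have h1 := hD.1.spectral_theorem
  set U := (hD.1.eigenvectorUnitary : Matrix (Fin m) (Fin m) ℝ) with hU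
  set e := hD.1.eigenvalues with he
  have hUU : U * star U = 1 := Unitary.coe_mul_star_self _
  have hUU' : star U * U = 1 := Unitary.coe_star_mul_self _
  have hst : star U = U.transpose := by
    rw [Matrix.star_eq_conjTranspose, Matrix.conjTranspose_eq_transpose_of_trivial]
  rw [hst] at hUU hUU'
  have h2 : C.transpose * M * C = U * Matrix.diagonal e * U.transpose := by
    rw [Unitary.conjStarAlgAut_apply] at h1
    rw [← hst]
    simpa [Function.comp_def] using h1
  have hCB' : B.transpose * C.transpose = 1 := by
    rw [← Matrix.transpose_mul, hCB, Matrix.transpose_one]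
  refine ⟨C * U, B.transpose * U, e, hD.eigenvalues_pos, ?_, ?_, ?_⟩
  · rw [hB]
    calc B.transpose * B * (C * U) = B.transpose * (B * C) * U := by simp only [Matrix.mul_assoc]
      _ = _ := by rw [hBC, Matrix.mul_one]
  · calc M * (C * U) = (B.transpose * C.transpose) * M * C * U := by
          rw [hCB', Matrix.one_mul, Matrix.mul_assoc]
      _ = B.transpose * (C.transpose * M * C) * U := by simp only [Matrix.mul_assoc]
      _ = B.transpose * U * Matrix.diagonal e * (U.transpose * U) := by
          rw [h2]; simp only [Matrix.mul_assoc]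
      _ = _ := by rw [hUU', Matrix.mul_one]
  · calc B.transpose * U * (C * U).transpose
        = B.transpose * (U * U.transpose) * C.transpose := by
          rw [Matrix.transpose_mul]; simp only [Matrix.mul_assoc]
      _ = 1 := by rw [hUU, Matrix.mul_one, hCB']

section abstractFix
variable {E : Type*} [NormedAddCommGroup E] [NormedSpace ℝ E] [CompleteSpace E]

theorem fix_unique (K : E →L[ℝ] E) (hK : ‖K * K‖ ≤ 1 / 4) (n : E → E) (r κ : ℝ)
    (hn : ∀ u ∈ Metric.closedBall (0 : E) r, ∀ v ∈ Metric.closedBall (0 : E) r,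
      ‖n u - n v‖ ≤ κ * ‖u - v‖) (hκ : (1 + ‖K‖) * κ ≤ 1 / 4)
    (u v : E) (hu : u ∈ Metric.closedBall (0 : E) r) (hv : v ∈ Metric.closedBall (0 : E) r)
    (hu0 : u + K u + n u = 0) (hv0 : v + K v + n v = 0) : u = v := by
  have h1 : (u - v) = K (K (u - v)) - ((n u - n v) - K (n u - n v)) := by
    have e1 : n u = -u - K u := by rw [← sub_eq_zero, ← hu0]; abel
    have e2 : n v = -v - K v := by rw [← sub_eq_zero, ← hv0]; abel
    rw [e1, e2]; simp only [map_sub, map_neg]; abel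
  have h2 : ‖K (K (u - v))‖ ≤ 1 / 4 * ‖u - v‖ :=
    ((K * K).le_opNorm (u - v)).trans (by gcongr)
  have h3 := hn u hu v hv
  have h4 : ‖K (n u - n v)‖ ≤ ‖K‖ * ‖n u - n v‖ := K.le_opNorm _
  have h5 : ‖u - v‖ ≤ 1 / 4 * ‖u - v‖ + (1 + ‖K‖) * (κ * ‖u - v‖) := by
    calc ‖u - v‖ = ‖K (K (u - v)) - ((n u - n v) - K (n u - n v))‖ := by rw [← h1]
      _ ≤ ‖K (K (u - v))‖ + (‖n u - n v‖ + ‖K (n u - n v)‖) :=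
        (norm_sub_le _ _).trans (by gcongr; exact norm_sub_le _ _)
      _ ≤ 1 / 4 * ‖u - v‖ + (1 + ‖K‖) * ‖n u - n v‖ := by linarith
      _ ≤ _ := by gcongr
  have h6 : (1 + ‖K‖) * (κ * ‖u - v‖) ≤ 1 / 4 * ‖u - v‖ := by
    rw [← mul_assoc]; gcongr
  have : ‖u - v‖ ≤ 0 := by linarith [norm_nonneg (u - v)]
  exact sub_eq_zero.1 (norm_le_zero_iff.1 this)

theorem fix_exists (K : E →L[ℝ] E) (hK : ‖K * K‖ ≤ 1 / 4) (n : E → E) (r κ : ℝ) (hr : 0 ≤ r)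
    (hn : ∀ u ∈ Metric.closedBall (0 : E) r, ∀ v ∈ Metric.closedBall (0 : E) r,
      ‖n u - n v‖ ≤ κ * ‖u - v‖) (hκ : (1 + ‖K‖) * κ ≤ 1 / 4)
    (h0 : (1 + ‖K‖) * ‖n 0‖ ≤ r / 2) :
    ∃ u : E, ‖u‖ ≤ 2 * ((1 + ‖K‖) * ‖n 0‖) ∧ u + K u + n u = 0 := by
  let Ψ : E → E := fun u => K (K u) - (n u - K (n u))
  have hlip : ∀ u ∈ Metric.closedBall (0 : E) r, ∀ v ∈ Metric.closedBall (0 : E) r,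
      ‖Ψ u - Ψ v‖ ≤ 1 / 2 * ‖u - v‖ := by
    intro u hu v hv
    have h1 : Ψ u - Ψ v = K (K (u - v)) - ((n u - n v) - K (n u - n v)) := by
      simp only [Ψ, map_sub]; abel
    have h2 : ‖K (K (u - v))‖ ≤ 1 / 4 * ‖u - v‖ :=
      ((K * K).le_opNorm (u - v)).trans (by gcongr)
    have h3 := hn u hu v hv
    have h4 : ‖K (n u - n v)‖ ≤ ‖K‖ * ‖n u - n v‖ := K.le_opNorm _
    have h6 : (1 + ‖K‖) * (κ * ‖u - v‖) ≤ 1 / 4 * ‖u - v‖ := by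
      rw [← mul_assoc]; gcongr
    calc ‖Ψ u - Ψ v‖ = ‖K (K (u - v)) - ((n u - n v) - K (n u - n v))‖ := by rw [h1]
      _ ≤ ‖K (K (u - v))‖ + (‖n u - n v‖ + ‖K (n u - n v)‖) :=
        (norm_sub_le _ _).trans (by gcongr; exact norm_sub_le _ _)
      _ ≤ 1 / 4 * ‖u - v‖ + (1 + ‖K‖) * ‖n u - n v‖ := by linarith
      _ ≤ 1 / 4 * ‖u - v‖ + (1 + ‖K‖) * (κ * ‖u - v‖) := by gcongr
      _ ≤ _ := by linarith
  have hΨ0 : ‖Ψ 0‖ ≤ (1 + ‖K‖) * ‖n 0‖ := by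
    have : Ψ 0 = -(n 0 - K (n 0)) := by simp [Ψ]
    rw [this, norm_neg]
    have := norm_sub_le (n 0) (K (n 0))
    have := K.le_opNorm (n 0)
    linarith
  have hz : (0 : E) ∈ Metric.closedBall (0 : E) r := Metric.mem_closedBall_self hr
  have hmaps : Set.MapsTo Ψ (Metric.closedBall 0 r) (Metric.closedBall 0 r) := by
    intro u hu
    have h1 := hlip u hu 0 hz
    rw [mem_closedBall_zero_iff] at hu ⊢
    rw [sub_zero] at h1
    have := norm_le_norm_add_norm_sub (Ψ 0) (Ψ u)
    have := norm_sub_rev (Ψ 0) (Ψ u)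
    linarith
  have hcontr : ContractingWith (1 / 2) (hmaps.restrict Ψ _ _) := by
    refine ⟨by norm_num, LipschitzWith.of_dist_le_mul fun u v => ?_⟩
    have := hlip u u.2 v v.2
    simp only [Subtype.dist_eq, Set.MapsTo.val_restrict_apply, dist_eq_norm]
    simpa using this
  obtain ⟨u, hus, hufix, -⟩ := hcontr.exists_fixedPoint' Metric.isClosed_closedBall.isComplete
    hmaps hz (edist_ne_top _ _)
  have hfix : Ψ u = u := hufix
  refine ⟨u, ?_, ?_⟩
  · have h1 := hlip u hus 0 hz
    rw [hfix, sub_zero] at h1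
    have := norm_le_norm_add_norm_sub (Ψ 0) u
    have := norm_sub_rev (Ψ 0) u
    linarith
  · set w := u + K u + n u with hw
    have h1 : w = K w := by
      have : K w = K u + K (K u) + K (n u) := by simp [hw]
      rw [this]
      have h2 : K (K u) = u + (n u - K (n u)) := sub_eq_iff_eq_add.1 hfix
      rw [h2, hw]; abel
    have h2 : ‖w‖ ≤ 1 / 4 * ‖w‖ := by
      calc ‖w‖ = ‖(K * K) w‖ := by
            change _ = ‖K (K w)‖
            rw [← h1, ← h1]
        _ ≤ _ := ((K * K).le_opNorm w).trans (by gcongr)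
    exact norm_le_zero_iff.1 (by linarith [norm_nonneg w])

theorem isUnit_near (K F : E →L[ℝ] E) (hK : ‖K * K‖ ≤ 1 / 4) (κ : ℝ)
    (hF : ‖F - (1 + K)‖ ≤ κ) (hκ : (1 + ‖K‖) * κ ≤ 1 / 4) : IsUnit F := by
  have hone : ‖(1 : E →L[ℝ] E)‖ ≤ 1 := ContinuousLinearMap.norm_id_le
  have h1 : IsUnit ((1 - K) * (1 + K)) := by
    have : (1 - K) * (1 + K) = 1 - K * K := by noncomm_ring
    rw [this]
    exact isUnit_one_sub_of_norm_lt_one (by linarith)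
  have hc : Commute (1 - K) (1 + K) := by
    have : (1 + K) * (1 - K) = (1 - K) * (1 + K) := by noncomm_ring
    exact this.symm
  have h2 : IsUnit (1 - K) := (hc.isUnit_mul_iff.1 h1).1
  have h3 : IsUnit ((1 - K) * F) := by
    have : (1 - K) * F = 1 - (K * K - (1 - K) * (F - (1 + K))) := by noncomm_ring
    rw [this]
    refine isUnit_one_sub_of_norm_lt_one ?_
    have h4 : ‖(1 - K) * (F - (1 + K))‖ ≤ (1 + ‖K‖) * κ := by
      refine (norm_mul_le _ _).trans ?_
      gcongr
      exact (norm_sub_le _ _).trans (by linarith)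
    have := norm_sub_le (K * K) ((1 - K) * (F - (1 + K)))
    linarith
  obtain ⟨a, ha⟩ := h2
  rw [← ha] at h3
  exact (Units.isUnit_units_mul a F).1 h3
end abstractFix

end Part1

section Part2

open BoundedContinuousFunction in
/-- uniform analyticity on a set -/
def UA {Z W : Type*} [NormedAddCommGroup Z] [NormedSpace ℝ Z] [NormedAddCommGroup W]
    [NormedSpace ℝ W] (f : Z → W) (s : Set Z) : Prop :=
  ∃ ρ : ℝ, 0 < ρ ∧ ∃ C : ℝ, 0 ≤ C ∧ ∀ z ∈ s,
    (∀ n : ℕ, ‖iteratedFDeriv ℝ n f z‖ * ρ ^ n ≤ C * n.factorial) ∧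
    ∀ y, ‖y‖ < ρ → HasSum (fun n : ℕ => (n.factorial : ℝ)⁻¹ • iteratedFDeriv ℝ n f z fun _ => y)
      (f (z + y))

section UAsec
variable {Z W : Type*} [NormedAddCommGroup Z] [NormedSpace ℝ Z] [NormedAddCommGroup W]
    [NormedSpace ℝ W]

theorem UA.mono {f : Z → W} {s t : Set Z} (h : UA f t) (hst : s ⊆ t) : UA f s := by
  obtain ⟨ρ, hρ, C, hC, h⟩ := h
  exact ⟨ρ, hρ, C, hC, fun z hz => h z (hst hz)⟩

theorem UA.union {f : Z → W} {s t : Set Z} (hs : UA f s) (ht : UA f t) : UA f (s ∪ t) := by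
  obtain ⟨ρ, hρ, C, hC, h⟩ := hs
  obtain ⟨ρ', hρ', C', hC', h'⟩ := ht
  have e1 : min ρ ρ' ≤ ρ := min_le_left _ _
  have e2 : min ρ ρ' ≤ ρ' := min_le_right _ _
  have e0 : 0 < min ρ ρ' := lt_min hρ hρ'
  refine ⟨min ρ ρ', e0, max C C', le_max_of_le_left hC, ?_⟩
  rintro z (hz | hz)
  · refine ⟨fun n => ?_, fun y hy => (h z hz).2 y (hy.trans_le e1)⟩
    calc _ ≤ ‖iteratedFDeriv ℝ n f z‖ * ρ ^ n := by gcongr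
      _ ≤ C * n.factorial := (h z hz).1 n
      _ ≤ _ := by gcongr; exact le_max_left _ _
  · refine ⟨fun n => ?_, fun y hy => (h' z hz).2 y (hy.trans_le e2)⟩
    calc _ ≤ ‖iteratedFDeriv ℝ n f z‖ * ρ' ^ n := by gcongr
      _ ≤ C' * n.factorial := (h' z hz).1 n
      _ ≤ _ := by gcongr; exact le_max_right _ _

theorem UA_local [CompleteSpace W] {f : Z → W} {z₀ : Z} (hf : AnalyticAt ℝ f z₀) :
    ∃ t ∈ nhds z₀, UA f t := by
  obtain ⟨p, r, hp⟩ := hf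
  obtain ⟨q, hq0, hqr⟩ := ENNReal.lt_iff_exists_nnreal_btwn.1 hp.r_pos
  have hq0' : 0 < q := by exact_mod_cast hq0
  set ρ : NNReal := q / 2 with hρ
  have hρ0 : 0 < ρ := by positivity
  have hρρ : ((ρ : ENNReal) + ρ) < r := by
    refine lt_of_le_of_lt ?_ hqr
    rw [← ENNReal.coe_add]
    exact_mod_cast (by rw [hρ]; exact (add_halves q).le)
  have hsum := p.changeOriginSeries_summable_aux₁ (hρρ.trans_le hp.r_le)
  refine ⟨Metric.ball z₀ ρ, Metric.ball_mem_nhds _ hρ0, ρ, hρ0, _, NNReal.coe_nonneg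
    (∑' s : Σ k l : ℕ, { s : Finset (Fin (k + l)) // s.card = l },
      ‖p (s.1 + s.2.1)‖₊ * ρ ^ s.2.1 * ρ ^ s.1), ?_⟩
  intro z hz
  set w := z - z₀ with hw
  have hwρ : ‖w‖₊ < ρ := by
    rw [← NNReal.coe_lt_coe]; simpa [hw, dist_eq_norm] using hz
  have hwr : (‖w‖₊ : ENNReal) < r := by
    refine lt_of_lt_of_le (ENNReal.coe_lt_coe.2 hwρ) (le_trans (by simp) hρρ.le)
  have hc := hp.changeOrigin hwr
  rw [show z₀ + w = z by simp [hw]] at hc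
  have hρr : (ρ : ENNReal) ≤ r - ‖w‖₊ := by
    refine ENNReal.le_sub_of_add_le_right (by simp) (le_trans ?_ hρρ.le)
    gcongr
  refine ⟨fun n => ?_, fun y hy => ?_⟩
  · have h1 : ‖p.changeOrigin w n‖₊ * ρ ^ n ≤
        ∑' s : Σ k l : ℕ, { s : Finset (Fin (k + l)) // s.card = l },
      ‖p (s.1 + s.2.1)‖₊ * ρ ^ s.2.1 * ρ ^ s.1 := by
      have h2 := p.nnnorm_changeOrigin_le n (hwr.trans_le hp.r_le)
      have h3 : Summable fun s : Σ l : ℕ, { s : Finset (Fin (n + l)) // s.card = l } =>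
          ‖p (n + s.1)‖₊ * ρ ^ s.1 * ρ ^ n := (NNReal.summable_sigma.1 hsum).1 n
      have h4 := p.changeOriginSeries_summable_aux₂ (hwr.trans_le hp.r_le) n
      calc ‖p.changeOrigin w n‖₊ * ρ ^ n ≤ _ := mul_le_mul_left h2 _
        _ = ∑' s : Σ l : ℕ, { s : Finset (Fin (n + l)) // s.card = l },
              ‖p (n + s.1)‖₊ * ‖w‖₊ ^ s.1 * ρ ^ n := by
            rw [NNReal.tsum_mul_right]
        _ ≤ ∑' s : Σ l : ℕ, { s : Finset (Fin (n + l)) // s.card = l },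
              ‖p (n + s.1)‖₊ * ρ ^ s.1 * ρ ^ n := by
            refine Summable.tsum_le_tsum (fun s => ?_) (h4.mul_right _) h3
            gcongr
        _ ≤ _ := by
            rw [hsum.tsum_sigma' (NNReal.summable_sigma.1 hsum).1]
            exact (NNReal.summable_sigma.1 hsum).2.le_tsum' n
    have h5 : ‖iteratedFDeriv ℝ n f z‖ ≤ n.factorial * ‖p.changeOrigin w n‖ := by
      refine ContinuousMultilinearMap.opNorm_le_bound (by positivity) fun v => ?_
      rw [hc.iteratedFDeriv_eq_sum_of_completeSpace]
      calc _ ≤ ∑ σ : Equiv.Perm (Fin n), ‖p.changeOrigin w n‖ * ∏ i, ‖v i‖ := by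
            refine (norm_sum_le _ _).trans (Finset.sum_le_sum fun σ _ => ?_)
            refine (ContinuousMultilinearMap.le_opNorm _ _).trans_eq ?_
            rw [Equiv.prod_comp σ (fun i => ‖v i‖)]
        _ = _ := by simp [Fintype.card_perm, mul_assoc]
    have h1' := NNReal.coe_le_coe.2 h1
    rw [NNReal.coe_mul, NNReal.coe_pow, coe_nnnorm] at h1'
    calc _ ≤ n.factorial * ‖p.changeOrigin w n‖ * (ρ : ℝ) ^ n := by gcongr
      _ = (‖p.changeOrigin w n‖ * (ρ : ℝ) ^ n) * n.factorial := by ring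
      _ ≤ _ := by gcongr
  · refine hc.hasSum_iteratedFDeriv ?_
    refine Metric.eball_subset_eball hρr ?_
    rw [Metric.eball_coe]
    simpa using hy

theorem UA_compact [CompleteSpace W] {f : Z → W} {s : Set Z} (hs : IsCompact s)
    (hf : ∀ z ∈ s, AnalyticAt ℝ f z) : UA f s := by
  refine hs.induction_on (p := UA f) ?_ (fun s t hst h => h.mono hst) (fun s t => UA.union) ?_
  · exact ⟨1, one_pos, 0, le_rfl, by simp⟩
  · intro z hz
    obtain ⟨t, ht, hU⟩ := UA_local (hf z hz)
    exact ⟨t, mem_nhdsWithin_of_mem_nhds ht, hU⟩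

open BoundedContinuousFunction in
/-- the multilinear coefficient of the Nemytskii operator -/
def nemCoeff {α : Type*} [TopologicalSpace α] (n : ℕ)
    (q : α → ContinuousMultilinearMap ℝ (fun _ : Fin n => Z) W) (hq : Continuous q) (B : ℝ)
    (hB : ∀ x, ‖q x‖ ≤ B) : ContinuousMultilinearMap ℝ (fun _ : Fin n => (α →ᵇ Z)) (α →ᵇ W) :=
  MultilinearMap.mkContinuous
    { toFun := fun v => BoundedContinuousFunction.ofNormedAddCommGroup
        (fun x => q x (fun i => v i x))
        (by
          have : Continuous fun x => (q x, fun i => v i x) :=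
            hq.prodMk (continuous_pi fun i => (v i).continuous)
          exact (continuous_eval (F := ContinuousMultilinearMap ℝ (fun _ : Fin n => Z) W)).comp this)
        (B * ∏ i, ‖v i‖)
        (fun x => ((q x).le_opNorm _).trans (by
          gcongr with i
          · exact (norm_nonneg _).trans (hB x)
          · exact hB x
          · exact (v i).norm_coe_le_norm x))
      map_update_add' := by
        intro _ v i a b
        ext x
        have key : ∀ a : α →ᵇ Z, (fun j => (Function.update v i a j) x) =
            Function.update (fun j => v j x) i (a x) := by
          intro a; ext j
          by_cases hj : j = i
          · subst hj; simp
          · simp [hj]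
        simp [key]
      map_update_smul' := by
        intro _ v i a b
        ext x
        have key : ∀ a : α →ᵇ Z, (fun j => (Function.update v i a j) x) =
            Function.update (fun j => v j x) i (a x) := by
          intro a; ext j
          by_cases hj : j = i
          · subst hj; simp
          · simp [hj]
        simp [key] }
    (max B 0)
    (fun v => by
      refine (BoundedContinuousFunction.norm_le (by positivity)).2 fun x => ?_
      refine ((q x).le_opNorm _).trans ?_
      gcongr with i
      · exact (hB x).trans (le_max_left _ _)
      · exact (v i).norm_coe_le_norm x)

open BoundedContinuousFunction in
theorem nem_analyticAt {α : Type*} [TopologicalSpace α] [CompleteSpace W] {f : Z → W}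
    (hf : ContDiff ℝ (⊤ : ℕ∞) f) {a : α → Z} (ha : Continuous a) (hU : UA f (Set.range a))
    (N : (α →ᵇ Z) → (α →ᵇ W)) (hN : ∀ v x, N v x = f (a x + v x)) : AnalyticAt ℝ N 0 := by
  obtain ⟨ρ, hρ, C, hC, h⟩ := hU
  have hcont : ∀ n : ℕ, Continuous fun x => (n.factorial : ℝ)⁻¹ • iteratedFDeriv ℝ n f (a x) := by
    intro n
    have h1 := (hf.continuous_iteratedFDeriv (m := n) (by exact_mod_cast le_top)).comp ha
    exact h1.const_smul (n.factorial : ℝ)⁻¹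
  have hbd : ∀ n : ℕ, ∀ x, ‖(n.factorial : ℝ)⁻¹ • iteratedFDeriv ℝ n f (a x)‖ ≤ C * (ρ ^ n)⁻¹ := by
    intro n x
    have h1 := (h (a x) ⟨x, rfl⟩).1 n
    rw [norm_smul, norm_inv, Real.norm_natCast]
    rw [← div_eq_mul_inv, le_div_iff₀ (by positivity), mul_assoc, inv_mul_le_iff₀ (by positivity)]
    linarith
  let p : FormalMultilinearSeries ℝ (α →ᵇ Z) (α →ᵇ W) := fun n => nemCoeff n _ (hcont n) _ (hbd n)
  have hpn : ∀ n, ‖p n‖ ≤ C * (ρ ^ n)⁻¹ := fun n =>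
    (MultilinearMap.mkContinuous_norm_le _ (le_max_right _ _) _).trans_eq
      (max_eq_left (by positivity))
  refine ⟨p, ENNReal.ofReal ρ, ?_, by simpa using hρ, ?_⟩
  · refine p.le_radius_of_bound C fun n => ?_
    rw [Real.coe_toNNReal _ hρ.le]
    calc _ ≤ C * (ρ ^ n)⁻¹ * ρ ^ n := by gcongr; exact hpn n
      _ = C := by field_simp
  · intro y hy
    have hy' : ‖y‖ < ρ := by
      rw [Metric.eball_ofReal] at hy; simpa using hy
    have hsumm : Summable fun n : ℕ => p n fun _ => y := by
      refine Summable.of_norm_bounded (g := fun n => C * (‖y‖ / ρ) ^ n)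
        ((summable_geometric_of_lt_one (by positivity) ((div_lt_one hρ).2 hy')).mul_left _)
        fun n => ?_
      refine ((p n).le_opNorm _).trans ?_
      rw [Finset.prod_const, Finset.card_univ, Fintype.card_fin, div_pow, div_eq_inv_mul,
        ← mul_assoc]
      gcongr
      exact hpn n
    have hval : N (0 + y) = ∑' n, p n fun _ => y := by
      ext x
      have h1 : HasSum (fun n : ℕ => (p n fun _ => y) x) ((∑' n, p n fun _ => y) x) :=
        hsumm.hasSum.mapL (BoundedContinuousFunction.evalCLM ℝ x)
      have h2 := (h (a x) ⟨x, rfl⟩).2 (y x) ((y.norm_coe_le_norm x).trans_lt hy')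
      rw [zero_add, hN]
      exact h2.unique h1
    rw [hval]
    exact hsumm.hasSum
end UAsec

end Part2

section Part3

open BoundedContinuousFunction

open Classical in
/-- turn a bounded continuous function into an element of the space -/
def bcf {α W : Type*} [TopologicalSpace α] [NormedAddCommGroup W] (F : α → W) : α →ᵇ W :=
  if h : Continuous F ∧ ∃ C, ∀ x, ‖F x‖ ≤ C then
    BoundedContinuousFunction.ofNormedAddCommGroup F h.1 h.2.choose h.2.choose_spec
  else 0

theorem bcf_apply {α W : Type*} [TopologicalSpace α] [NormedAddCommGroup W] {F : α → W}
    (hF : Continuous F) (hb : ∃ C, ∀ x, ‖F x‖ ≤ C) (x : α) : bcf F x = F x := by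
  rw [bcf, dif_pos ⟨hF, hb⟩]; rfl

/-- lattice vector -/
def per {d : ℕ} (k : Fin d → ℤ) : Fin d → ℝ := fun j => 2 * π * k j

theorem exists_reduce {d : ℕ} (ψ : Fin d → ℝ) :
    ∃ k : Fin d → ℤ, ψ + per k ∈ Set.univ.pi fun _ : Fin d => Set.Icc (0 : ℝ) (2 * π) := by
  refine ⟨fun j => -⌊ψ j / (2 * π)⌋, fun j _ => ?_⟩
  have hp : 0 < 2 * π := Real.two_pi_pos
  have h1 := Int.floor_le (ψ j / (2 * π))
  have h2 := Int.lt_floor_add_one (ψ j / (2 * π))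
  rw [le_div_iff₀ hp] at h1
  rw [div_lt_iff₀ hp] at h2
  simp only [per, Pi.add_apply, Set.mem_Icc, Int.cast_neg]
  constructor <;> nlinarith

section Nem
variable {d : ℕ} {V W : Type*} [NormedAddCommGroup V] [NormedSpace ℝ V] [FiniteDimensional ℝ V]
  [NormedAddCommGroup W] [NormedSpace ℝ W] [CompleteSpace W]

/-- analytic and periodic in the second argument -/
structure AnPer (f : V × (Fin d → ℝ) → W) : Prop where
  an : AnalyticOnNhd ℝ f Set.univ
  per : ∀ x ψ k, f (x, ψ + per k) = f (x, ψ)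

theorem AnPer.bounded {f : V × (Fin d → ℝ) → W} (hf : AnPer f) (R : ℝ) :
    ∃ C, ∀ x ψ, ‖x‖ ≤ R → ‖f (x, ψ)‖ ≤ C := by
  have : ProperSpace V := FiniteDimensional.proper ℝ V
  have hK : IsCompact ((Metric.closedBall (0 : V) R) ×ˢ
      (Set.univ.pi fun _ : Fin d => Set.Icc (0 : ℝ) (2 * π))) :=
    (isCompact_closedBall _ _).prod (isCompact_univ_pi fun _ => isCompact_Icc)
  obtain ⟨C, hC⟩ := hK.exists_bound_of_continuousOn
    (f := f) (hf.an.continuousOn.mono (Set.subset_univ _))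
  refine ⟨C, fun x ψ hx => ?_⟩
  obtain ⟨k, hk⟩ := exists_reduce ψ
  rw [← hf.per x ψ k]
  exact hC _ ⟨by simpa using hx, hk⟩

theorem AnPer.ua {f : V × (Fin d → ℝ) → W} (hf : AnPer f) (R : ℝ) :
    UA f {z | ‖z.1‖ ≤ R} := by
  have : ProperSpace V := FiniteDimensional.proper ℝ V
  have hK : IsCompact ((Metric.closedBall (0 : V) R) ×ˢ
      (Set.univ.pi fun _ : Fin d => Set.Icc (0 : ℝ) (2 * π))) :=
    (isCompact_closedBall _ _).prod (isCompact_univ_pi fun _ => isCompact_Icc)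
  obtain ⟨ρ, hρ, C, hC, h⟩ := UA_compact hK (fun z _ => hf.an z (Set.mem_univ _))
  refine ⟨ρ, hρ, C, hC, ?_⟩
  rintro ⟨x, ψ⟩ hx
  obtain ⟨k, hk⟩ := exists_reduce ψ
  have h1 := h (x, ψ + _root_.per k) ⟨by simpa using hx, hk⟩
  have h2 : (fun z => f (z + ((0 : V), _root_.per k))) = f := by
    ext ⟨x, ψ⟩
    simpa using hf.per x ψ k
  have h3 : ∀ n, iteratedFDeriv ℝ n f (x, ψ + _root_.per k) = iteratedFDeriv ℝ n f (x, ψ) := by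
    intro n
    have := iteratedFDeriv_comp_add_right (𝕜 := ℝ) (f := f) n ((0 : V), _root_.per k) (x, ψ)
    rw [h2] at this
    simpa using this.symm
  have h4 : ∀ y, f ((x, ψ + _root_.per k) + y) = f ((x, ψ) + y) := by
    rintro ⟨y1, y2⟩
    have := hf.per (x + y1) (ψ + y2) k
    simp only [Prod.mk_add_mk]
    rw [← this]; congr 2; abel
  simpa only [h3, h4] using h1

/-- the Nemytskii operator -/
def nem (f : V × (Fin d → ℝ) → W) (p : (Fin d → ℝ) × ((Fin d → ℝ) →ᵇ V)) : (Fin d → ℝ) →ᵇ W :=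
  bcf fun ψ => f (p.2 ψ, ψ + p.1)

theorem nem_apply {f : V × (Fin d → ℝ) → W} (hf : AnPer f) (p : (Fin d → ℝ) × ((Fin d → ℝ) →ᵇ V))
    (ψ : Fin d → ℝ) : nem f p ψ = f (p.2 ψ, ψ + p.1) := by
  refine bcf_apply (F := fun ψ => f (p.2 ψ, ψ + p.1)) ?_ ?_ ψ
  · have : Continuous f := by
      rw [← continuousOn_univ]; exact hf.an.continuousOn
    exact this.comp (by fun_prop)
  · obtain ⟨C, hC⟩ := hf.bounded ‖p.2‖
    exact ⟨C, fun x => hC _ _ (p.2.norm_coe_le_norm x)⟩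

/-- constants as bounded continuous functions -/
def constL (α V : Type*) [TopologicalSpace α] [NormedAddCommGroup V] [NormedSpace ℝ V] :
    V →L[ℝ] (α →ᵇ V) :=
  LinearMap.mkContinuous
    { toFun := fun v => BoundedContinuousFunction.const α v
      map_add' := fun _ _ => rfl
      map_smul' := fun _ _ => rfl } 1 (fun v => by
        rw [one_mul]; exact BoundedContinuousFunction.norm_const_le v)

@[simp] theorem constL_apply (α V : Type*) [TopologicalSpace α] [NormedAddCommGroup V]
    [NormedSpace ℝ V] (v : V) (x : α) : constL α V v x = v := rfl

theorem nem_analytic {f : V × (Fin d → ℝ) → W} (hf : AnPer f)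
    (p : (Fin d → ℝ) × ((Fin d → ℝ) →ᵇ V)) : AnalyticAt ℝ (nem f) p := by
  let a : (Fin d → ℝ) → V × (Fin d → ℝ) := fun ψ => (p.2 ψ, ψ + p.1)
  have ha : Continuous a := by fun_prop
  have hfc : Continuous f := by
      rw [← continuousOn_univ]; exact hf.an.continuousOn
  let N : ((Fin d → ℝ) →ᵇ V × (Fin d → ℝ)) → ((Fin d → ℝ) →ᵇ W) := fun v =>
    bcf fun ψ => f (a ψ + v ψ)
  have hN : ∀ v x, N v x = f (a x + v x) := by
    intro v x
    refine bcf_apply (F := fun ψ => f (a ψ + v ψ)) (hfc.comp (by fun_prop)) ?_ x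
    obtain ⟨C, hC⟩ := hf.bounded (‖p.2‖ + ‖v‖)
    refine ⟨C, fun x => hC _ _ ?_⟩
    refine (norm_add_le _ _).trans (add_le_add (p.2.norm_coe_le_norm x) ?_)
    exact (norm_fst_le (v x)).trans (v.norm_coe_le_norm x)
  have hUA : UA f (Set.range a) := by
    refine (hf.ua ‖p.2‖).mono ?_
    rintro _ ⟨ψ, rfl⟩
    exact p.2.norm_coe_le_norm ψ
  have hcd : ContDiff ℝ (⊤ : ℕ∞) f := by
    rw [← contDiffOn_univ]
    exact hf.an.contDiffOn uniqueDiffOn_univ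
  have h0 : AnalyticAt ℝ N 0 := nem_analyticAt hcd ha hUA N hN
  let L : (Fin d → ℝ) × ((Fin d → ℝ) →ᵇ V) →L[ℝ] ((Fin d → ℝ) →ᵇ V × (Fin d → ℝ)) :=
    ((ContinuousLinearMap.inl ℝ V (Fin d → ℝ)).compLeftContinuousBounded (Fin d → ℝ)).comp
      (ContinuousLinearMap.snd ℝ _ _) +
    ((ContinuousLinearMap.inr ℝ V (Fin d → ℝ)).compLeftContinuousBounded (Fin d → ℝ)).comp
      ((constL (Fin d → ℝ) (Fin d → ℝ)).comp (ContinuousLinearMap.fst ℝ _ _))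
  have hfun : nem f = N ∘ fun q => L (q - p) := by
    ext1 q
    ext1 ψ
    rw [nem_apply hf, Function.comp_apply, hN]
    congr 1
    simp [L, a]
  rw [hfun]
  have hg : AnalyticAt ℝ (fun q => L (q - p)) p :=
    AnalyticAt.fun_comp (f := fun q => q - p) (g := fun q => L q) (L.analyticAt _)
      (analyticAt_id.sub analyticAt_const)
  have h0' : AnalyticAt ℝ N ((fun q => L (q - p)) p) := by
    have : (fun q => L (q - p)) p = 0 := by
      show L (p - p) = 0
      rw [sub_self, map_zero]
    rw [this]; exact h0
  exact AnalyticAt.comp h0' hg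

end Nem

end Part3

section Part4

open BoundedContinuousFunction MeasureTheory

section JJ
variable {d : ℕ}

/-- translation -/
def tr (W : Type*) [NormedAddCommGroup W] [NormedSpace ℝ W] (θ : Fin d → ℝ) :
    ((Fin d → ℝ) →ᵇ W) →L[ℝ] ((Fin d → ℝ) →ᵇ W) :=
  LinearMap.mkContinuous
    { toFun := fun f => f.compContinuous ⟨fun ψ => ψ + θ, by fun_prop⟩
      map_add' := fun _ _ => rfl
      map_smul' := fun _ _ => rfl } 1 (fun f => by
        rw [one_mul]
        refine (BoundedContinuousFunction.norm_le (norm_nonneg _)).2 fun x => f.norm_coe_le_norm _)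

@[simp] theorem tr_apply {W : Type*} [NormedAddCommGroup W] [NormedSpace ℝ W] (θ : Fin d → ℝ)
    (f : (Fin d → ℝ) →ᵇ W) (ψ) : tr W θ f ψ = f (ψ + θ) := rfl

theorem tr_norm_le {W : Type*} [NormedAddCommGroup W] [NormedSpace ℝ W] (θ : Fin d → ℝ)
    (f : (Fin d → ℝ) →ᵇ W) : ‖tr W θ f‖ ≤ ‖f‖ :=
  (BoundedContinuousFunction.norm_le (norm_nonneg _)).2 fun _ => f.norm_coe_le_norm _

theorem exp_neg_int : IntegrableOn (fun s : ℝ => Real.exp (-s)) (Set.Ioi 0) :=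
  integrableOn_exp_neg_Ioi 0

theorem J_integrable (ω : Fin d → ℝ) (τ : ℝ) (f : (Fin d → ℝ) →ᵇ ℝ) (ψ : Fin d → ℝ) :
    IntegrableOn (fun s : ℝ => Real.exp (-s) * f (ψ - (τ * s) • ω)) (Set.Ioi 0) := by
  refine Integrable.mono' (exp_neg_int.mul_const ‖f‖) ?_ ?_
  · exact Continuous.aestronglyMeasurable (by fun_prop)
  · refine Eventually.of_forall fun s => ?_
    rw [norm_mul, Real.norm_of_nonneg (Real.exp_pos _).le]
    exact mul_le_mul_of_nonneg_left (f.norm_coe_le_norm _) (Real.exp_pos _).le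

theorem J_bound (ω : Fin d → ℝ) (τ : ℝ) (f : (Fin d → ℝ) →ᵇ ℝ) (ψ : Fin d → ℝ) :
    ‖∫ s in Set.Ioi (0 : ℝ), Real.exp (-s) * f (ψ - (τ * s) • ω)‖ ≤ ‖f‖ := by
  have h := norm_integral_le_of_norm_le (μ := volume.restrict (Set.Ioi (0 : ℝ)))
    (f := fun s => Real.exp (-s) * f (ψ - (τ * s) • ω)) (exp_neg_int.mul_const ‖f‖)
    (Eventually.of_forall fun s => by
      rw [norm_mul, Real.norm_of_nonneg (Real.exp_pos _).le]
      exact mul_le_mul_of_nonneg_left (f.norm_coe_le_norm _) (Real.exp_pos _).le)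
  rwa [integral_mul_const, integral_exp_neg_Ioi_zero, one_mul] at h

theorem J_cont (ω : Fin d → ℝ) (τ : ℝ) (f : (Fin d → ℝ) →ᵇ ℝ) :
    Continuous fun ψ => ∫ s in Set.Ioi (0 : ℝ), Real.exp (-s) * f (ψ - (τ * s) • ω) := by
  refine continuous_of_dominated (bound := fun s => Real.exp (-s) * ‖f‖) ?_ ?_
    (exp_neg_int.mul_const ‖f‖) ?_
  · intro ψ; exact Continuous.aestronglyMeasurable (by fun_prop)
  · refine fun ψ => Eventually.of_forall fun s => ?_
    rw [norm_mul, Real.norm_of_nonneg (Real.exp_pos _).le]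
    exact mul_le_mul_of_nonneg_left (f.norm_coe_le_norm _) (Real.exp_pos _).le
  · exact Eventually.of_forall fun s => by fun_prop

/-- the resolvent `(1 + τ ω·∂)⁻¹` -/
def J (ω : Fin d → ℝ) (τ : ℝ) : ((Fin d → ℝ) →ᵇ ℝ) →L[ℝ] ((Fin d → ℝ) →ᵇ ℝ) :=
  LinearMap.mkContinuous
    { toFun := fun f => BoundedContinuousFunction.ofNormedAddCommGroup _ (J_cont ω τ f) ‖f‖
        (J_bound ω τ f)
      map_add' := fun f g => by
        ext ψ
        simp only [coe_ofNormedAddCommGroup, BoundedContinuousFunction.coe_add, Pi.add_apply,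
          mul_add]
        exact integral_add (J_integrable ω τ f ψ) (J_integrable ω τ g ψ)
      map_smul' := fun a f => by
        ext ψ
        simp only [coe_ofNormedAddCommGroup, BoundedContinuousFunction.coe_smul, smul_eq_mul,
          RingHom.id_apply]
        rw [← integral_const_mul]
        congr 1; ext s; ring } 1 (fun f => by
        rw [one_mul]
        exact (BoundedContinuousFunction.norm_le (norm_nonneg _)).2 (J_bound ω τ f))

theorem J_apply (ω : Fin d → ℝ) (τ : ℝ) (f : (Fin d → ℝ) →ᵇ ℝ) (ψ) :
    J ω τ f ψ = ∫ s in Set.Ioi (0 : ℝ), Real.exp (-s) * f (ψ - (τ * s) • ω) := rfl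

theorem J_norm_le (ω : Fin d → ℝ) (τ : ℝ) (f : (Fin d → ℝ) →ᵇ ℝ) : ‖J ω τ f‖ ≤ ‖f‖ :=
  (BoundedContinuousFunction.norm_le (norm_nonneg _)).2 (J_bound ω τ f)

theorem J_tr (ω : Fin d → ℝ) (τ : ℝ) (θ) (f : (Fin d → ℝ) →ᵇ ℝ) :
    J ω τ (tr ℝ θ f) = tr ℝ θ (J ω τ f) := by
  ext ψ
  simp only [J_apply, tr_apply]
  congr 1; ext s; congr 2; abel

theorem J_close (ω : Fin d → ℝ) {τ : ℝ} (hτ : 0 ≤ τ) (g : (Fin d → ℝ) →ᵇ ℝ) {ℓ : ℝ}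
    (hg : ∀ ψ (t : ℝ), ‖g (ψ + t • ω) - g ψ‖ ≤ ℓ * |t|) : ‖J ω τ g - g‖ ≤ τ * ℓ := by
  have hl : 0 ≤ ℓ := by
    have := (norm_nonneg _).trans (hg 0 1); simpa using this
  refine (BoundedContinuousFunction.norm_le (by positivity)).2 fun ψ => ?_
  have h1 : (J ω τ g - g) ψ =
      ∫ s in Set.Ioi (0 : ℝ), Real.exp (-s) * (g (ψ - (τ * s) • ω) - g ψ) := by
    simp only [mul_sub]
    rw [integral_sub (J_integrable ω τ g ψ) (exp_neg_int.mul_const _), integral_mul_const,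
      integral_exp_neg_Ioi_zero, one_mul]
    rfl
  have hG : IntegrableOn (fun s : ℝ => Real.exp (-s) * s) (Set.Ioi 0) := by
    have := Real.GammaIntegral_convergent (s := 2) (by norm_num)
    refine this.congr_fun (fun s hs => ?_) measurableSet_Ioi
    norm_num
  have hG1 : ∫ s in Set.Ioi (0 : ℝ), Real.exp (-s) * s = 1 := by
    have := Real.Gamma_eq_integral (s := 2) (by norm_num)
    rw [Real.Gamma_two] at this
    rw [this]
    refine setIntegral_congr_fun measurableSet_Ioi (fun s hs => ?_)
    norm_num
  rw [h1]
  have h := norm_integral_le_of_norm_le (μ := volume.restrict (Set.Ioi (0 : ℝ)))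
    (f := fun s => Real.exp (-s) * (g (ψ - (τ * s) • ω) - g ψ)) (hG.mul_const (τ * ℓ))
    ((ae_restrict_mem measurableSet_Ioi).mono fun s hs => by
      have hs : 0 < s := hs
      rw [norm_mul, Real.norm_of_nonneg (Real.exp_pos _).le, mul_assoc]
      refine mul_le_mul_of_nonneg_left ?_ (Real.exp_pos _).le
      have := hg ψ (-(τ * s))
      rw [neg_smul, ← sub_eq_add_neg, abs_neg, abs_of_nonneg (by positivity)] at this
      linarith)
  rwa [integral_mul_const, hG1, one_mul] at h

theorem J_line (ω : Fin d → ℝ) {τ : ℝ} (hτ : 0 < τ) (f : (Fin d → ℝ) →ᵇ ℝ) (ψ : Fin d → ℝ)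
    (t : ℝ) : J ω τ f (ψ + t • ω) =
      (τ⁻¹ * Real.exp (-(t / τ))) * ∫ r in Set.Iio t, Real.exp (r / τ) * f (ψ + r • ω) := by
  have e1 := integral_comp_mul_left_Ioi
    (fun x => Real.exp (-(x / τ)) * f (ψ + (t - x) • ω)) 0 hτ
  have e2 : J ω τ f (ψ + t • ω) =
      ∫ s in Set.Ioi (0 : ℝ), Real.exp (-(τ * s / τ)) * f (ψ + (t - τ * s) • ω) := by
    rw [J_apply]
    congr 1; ext s; congr 2
    · rw [mul_div_cancel_left₀ _ hτ.ne']
    · rw [sub_smul]; abel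
  rw [e2, e1, mul_zero, smul_eq_mul, mul_assoc]
  congr 1
  rw [← integral_const_mul]
  rw [← integral_indicator measurableSet_Ioi, ← integral_indicator measurableSet_Iio]
  refine Eq.trans ?_ (integral_sub_left_eq_self _ volume t)
  congr 1
  ext x
  by_cases hx : 0 < x
  · rw [Set.indicator_of_mem (by simpa using hx), Set.indicator_of_mem (by simpa using hx)]
    rw [← mul_assoc, ← Real.exp_add]
    congr 2; ring
  · rw [Set.indicator_of_notMem (by simpa using hx), Set.indicator_of_notMem (by simpa using hx)]

theorem J_deriv (ω : Fin d → ℝ) {τ : ℝ} (hτ : 0 < τ) (f : (Fin d → ℝ) →ᵇ ℝ) (ψ : Fin d → ℝ)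
    (t : ℝ) : HasDerivAt (fun t : ℝ => J ω τ f (ψ + t • ω))
      ((f (ψ + t • ω) - J ω τ f (ψ + t • ω)) / τ) t := by
  set k : ℝ → ℝ := fun r => Real.exp (r / τ) * f (ψ + r • ω) with hk
  have hkc : Continuous k := by fun_prop
  have hki : ∀ t, IntegrableOn k (Set.Iic t) := by
    intro t
    have : IntegrableOn (fun r : ℝ => Real.exp (τ⁻¹ * r)) (Set.Iic t) :=
      integrableOn_exp_mul_Iic (by positivity) t
    refine Integrable.mono' (this.mul_const ‖f‖) hkc.aestronglyMeasurable ?_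
    refine Eventually.of_forall fun s => ?_
    simp only [hk]
    rw [norm_mul, Real.norm_of_nonneg (Real.exp_pos _).le, div_eq_inv_mul]
    exact mul_le_mul_of_nonneg_left (f.norm_coe_le_norm _) (Real.exp_pos _).le
  have e : (fun t : ℝ => J ω τ f (ψ + t • ω)) = fun t =>
      (τ⁻¹ * Real.exp (-(t / τ))) * ((∫ r in (0:ℝ)..t, k r) + ∫ r in Set.Iic 0, k r) := by
    ext t
    rw [J_line ω hτ, ← integral_Iic_eq_integral_Iio,
      ← intervalIntegral.integral_Iic_sub_Iic (hki 0) (hki t), sub_add_cancel]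
  have hd : HasDerivAt (fun t => (∫ r in (0:ℝ)..t, k r) + ∫ r in Set.Iic 0, k r) (k t) t :=
    (intervalIntegral.integral_hasDerivAt_right (hkc.intervalIntegrable _ _)
      hkc.aestronglyMeasurable.stronglyMeasurableAtFilter hkc.continuousAt).add_const _
  have he : HasDerivAt (fun t => τ⁻¹ * Real.exp (-(t / τ)))
      (τ⁻¹ * (Real.exp (-(t / τ)) * (-(1 / τ)))) t :=
    (((hasDerivAt_id t).div_const τ).neg.exp).const_mul _
  have := he.mul hd
  have et := congrFun e t
  rw [et, e]
  refine HasDerivAt.congr_deriv this ?_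
  have h1 : Real.exp (-(t / τ)) * k t = f (ψ + t • ω) := by
    simp only [hk]
    rw [← mul_assoc, ← Real.exp_add]; simp
  rw [← h1]
  field_simp
  ring

end JJ

end Part4

section Part5

open BoundedContinuousFunction MeasureTheory

section OpSec
variable {d m : ℕ}

/-- constant linear map acting on functions -/
abbrev lft {V W : Type*} [NormedAddCommGroup V] [NormedSpace ℝ V]
    [NormedAddCommGroup W] [NormedSpace ℝ W] (B : V →L[ℝ] W) :
    ((Fin d → ℝ) →ᵇ V) →L[ℝ] ((Fin d → ℝ) →ᵇ W) := B.compLeftContinuousBounded (Fin d → ℝ)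

theorem lft_norm_le {V W : Type*} [NormedAddCommGroup V] [NormedSpace ℝ V]
    [NormedAddCommGroup W] [NormedSpace ℝ W] (B : V →L[ℝ] W) (f : (Fin d → ℝ) →ᵇ V) :
    ‖lft B f‖ ≤ ‖B‖ * ‖f‖ :=
  (BoundedContinuousFunction.norm_le (by positivity)).2 fun ψ =>
    (B.le_opNorm _).trans (mul_le_mul_of_nonneg_left (f.norm_coe_le_norm _) (norm_nonneg _))

/-- matrix as continuous linear map -/
def mcl (B : Matrix (Fin m) (Fin m) ℝ) : (Fin m → ℝ) →L[ℝ] (Fin m → ℝ) :=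
  LinearMap.toContinuousLinearMap B.mulVecLin

@[simp] theorem mcl_apply (B : Matrix (Fin m) (Fin m) ℝ) (v) : mcl B v = B.mulVec v := rfl

/-- Lipschitz along the flow -/
def LipW {V : Type*} [NormedAddCommGroup V] [NormedSpace ℝ V]
    (ω : Fin d → ℝ) (g : (Fin d → ℝ) →ᵇ V) (ℓ : ℝ) : Prop :=
  ∀ t : ℝ, ‖tr V (t • ω) g - g‖ ≤ ℓ * |t|

theorem LipW.map {V W : Type*} [NormedAddCommGroup V] [NormedSpace ℝ V]
    [NormedAddCommGroup W] [NormedSpace ℝ W] {ω : Fin d → ℝ} {g : (Fin d → ℝ) →ᵇ V} {ℓ : ℝ}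
    (hg : LipW ω g ℓ) (R : ((Fin d → ℝ) →ᵇ V) →L[ℝ] ((Fin d → ℝ) →ᵇ W)) {C : ℝ} (hC : 0 ≤ C)
    (hR : ∀ f, ‖R f‖ ≤ C * ‖f‖) (hT : ∀ θ f, R (tr V θ f) = tr W θ (R f)) :
    LipW ω (R g) (C * ℓ) := by
  intro t
  rw [← hT, ← map_sub, mul_assoc]
  exact (hR _).trans (mul_le_mul_of_nonneg_left (hg t) hC)

theorem lft_tr {V W : Type*} [NormedAddCommGroup V] [NormedSpace ℝ V]
    [NormedAddCommGroup W] [NormedSpace ℝ W] (B : V →L[ℝ] W) (θ) (f : (Fin d → ℝ) →ᵇ V) :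
    lft B (tr V θ f) = tr W θ (lft B f) := rfl

/-- diagonalised resolvent -/
def op (ω : Fin d → ℝ) (τ : Fin m → ℝ) (a : Fin m → Fin m → ℝ)
    (b : Fin m → (Fin m → ℝ) →L[ℝ] ℝ) :
    ((Fin d → ℝ) →ᵇ (Fin m → ℝ)) →L[ℝ] ((Fin d → ℝ) →ᵇ (Fin m → ℝ)) :=
  ∑ i, (lft (ContinuousLinearMap.smulRight (1 : ℝ →L[ℝ] ℝ) (a i))).comp
    ((J ω (τ i)).comp (lft (b i)))

variable (ω : Fin d → ℝ) (τ : Fin m → ℝ) (a : Fin m → Fin m → ℝ)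
    (b : Fin m → (Fin m → ℝ) →L[ℝ] ℝ)

theorem op_apply (f) (ψ) : op ω τ a b f ψ = ∑ i, (J ω (τ i) (lft (b i) f) ψ) • a i := by
  simp [op, BoundedContinuousFunction.sum_apply]

theorem op_norm (f) : ‖op ω τ a b f‖ ≤ (∑ i, ‖a i‖ * ‖b i‖) * ‖f‖ := by
  refine (BoundedContinuousFunction.norm_le (by positivity)).2 fun ψ => ?_
  rw [op_apply, Finset.sum_mul]
  refine norm_sum_le_of_le _ fun i _ => ?_
  rw [norm_smul]
  have h1 := (J ω (τ i) (lft (b i) f)).norm_coe_le_norm ψ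
  have h2 := h1.trans ((J_norm_le _ _ _).trans (lft_norm_le (b i) f))
  nlinarith [norm_nonneg (a i)]

theorem op_tr (θ f) : op ω τ a b (tr _ θ f) = tr _ θ (op ω τ a b f) := by
  ext1 ψ
  rw [tr_apply, op_apply, op_apply]
  refine Finset.sum_congr rfl fun i _ => ?_
  rw [lft_tr, J_tr, tr_apply]

theorem op_deriv (hτ : ∀ i, 0 < τ i) (f ψ t) :
    HasDerivAt (fun t : ℝ => op ω τ a b f (ψ + t • ω))
      (∑ i, ((b i (f (ψ + t • ω)) - J ω (τ i) (lft (b i) f) (ψ + t • ω)) / τ i) • a i) t := by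
  simp only [op_apply]
  exact HasDerivAt.fun_sum fun i _ => (J_deriv ω (hτ i) (lft (b i) f) ψ t).smul_const (a i)

theorem op_close (hτ : ∀ i, 0 ≤ τ i) (g) {ℓ : ℝ} (hg : LipW ω g ℓ)
    (B : (Fin m → ℝ) →L[ℝ] (Fin m → ℝ)) (hB : ∀ v, B v = ∑ i, b i v • a i) :
    ‖op ω τ a b g - lft B g‖ ≤ (∑ i, τ i * (‖a i‖ * ‖b i‖)) * ℓ := by
  have hl : 0 ≤ ℓ := by simpa using (norm_nonneg _).trans (hg 1)
  have h0 : 0 ≤ ∑ i, τ i * (‖a i‖ * ‖b i‖) :=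
    Finset.sum_nonneg fun i _ => mul_nonneg (hτ i) (by positivity)
  refine (BoundedContinuousFunction.norm_le (by positivity)).2 fun ψ => ?_
  have h1 : (op ω τ a b g - lft B g) ψ =
      ∑ i, ((J ω (τ i) (lft (b i) g) - lft (b i) g) ψ) • a i := by
    rw [BoundedContinuousFunction.sub_apply, op_apply]
    have : lft B g ψ = ∑ i, b i (g ψ) • a i := hB _
    rw [this, ← Finset.sum_sub_distrib]
    refine Finset.sum_congr rfl fun i _ => ?_
    rw [← sub_smul]; rfl
  rw [h1, Finset.sum_mul]
  refine norm_sum_le_of_le _ fun i _ => ?_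
  rw [norm_smul]
  have h2 : ‖J ω (τ i) (lft (b i) g) - lft (b i) g‖ ≤ τ i * (‖b i‖ * ℓ) := by
    refine J_close ω (hτ i) _ fun ψ t => ?_
    have := (hg.map (lft (b i)) (norm_nonneg _) (lft_norm_le (b i)) (lft_tr (b i))) t
    exact ((tr ℝ (t • ω) (lft (b i) g) - lft (b i) g).norm_coe_le_norm ψ).trans this
  have h3 := ((J ω (τ i) (lft (b i) g) - lft (b i) g).norm_coe_le_norm ψ).trans h2
  calc _ ≤ τ i * (‖b i‖ * ℓ) * ‖a i‖ := mul_le_mul_of_nonneg_right h3 (norm_nonneg _)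
    _ = _ := by ring

theorem op_lip (hτ : ∀ i, 0 < τ i) (f) :
    LipW ω (op ω τ a b f) ((∑ i, 2 / τ i * (‖a i‖ * ‖b i‖)) * ‖f‖) := by
  intro t
  have h0 : 0 ≤ ∑ i, 2 / τ i * (‖a i‖ * ‖b i‖) :=
    Finset.sum_nonneg fun i _ => mul_nonneg (div_nonneg (by norm_num) (hτ i).le) (by positivity)
  refine (BoundedContinuousFunction.norm_le (by positivity)).2 fun ψ => ?_
  have := Convex.norm_image_sub_le_of_norm_hasDerivWithin_le (s := Set.univ) (x := 0) (y := t)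
    (f := fun t : ℝ => op ω τ a b f (ψ + t • ω))
    (C := (∑ i, 2 / τ i * (‖a i‖ * ‖b i‖)) * ‖f‖)
    (fun t _ => (op_deriv ω τ a b hτ f ψ t).hasDerivWithinAt) (fun t _ => ?_) convex_univ
    (Set.mem_univ _) (Set.mem_univ _)
  · simpa using this
  · rw [Finset.sum_mul]
    refine norm_sum_le_of_le _ fun i _ => ?_
    rw [norm_smul, norm_div, Real.norm_of_nonneg (hτ i).le]
    have h1 : ‖b i (f (ψ + t • ω))‖ ≤ ‖b i‖ * ‖f‖ :=
      ((lft (b i) f).norm_coe_le_norm (ψ + t • ω)).trans (lft_norm_le _ _)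
    have h2 := ((J ω (τ i) (lft (b i) f)).norm_coe_le_norm (ψ + t • ω)).trans
      ((J_norm_le _ _ _).trans (lft_norm_le (b i) f))
    have h3 := (norm_sub_le (b i (f (ψ + t • ω))) (J ω (τ i) (lft (b i) f) (ψ + t • ω))).trans
      (add_le_add h1 h2)
    calc _ ≤ (‖b i‖ * ‖f‖ + ‖b i‖ * ‖f‖) / τ i * ‖a i‖ := by gcongr; exact (hτ i).le
      _ = _ := by ring

/-- row functional of a column of a matrix -/
def colF (P : Matrix (Fin m) (Fin m) ℝ) (i : Fin m) : (Fin m → ℝ) →L[ℝ] ℝ :=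
  (ContinuousLinearMap.proj i).comp (mcl P.transpose)

theorem colF_apply (P : Matrix (Fin m) (Fin m) ℝ) (i v) :
    colF P i v = P.transpose.mulVec v i := rfl

theorem sum_smul_col (P : Matrix (Fin m) (Fin m) ℝ) (y : Fin m → ℝ) :
    ∑ i, y i • P.col i = P.mulVec y := by
  ext k
  simp [Matrix.mulVec, dotProduct, Matrix.col, mul_comm]

theorem exists_S (M Γ : Matrix (Fin m) (Fin m) ℝ) (hM : M.PosDef) (hΓ : Γ.PosDef) :
    ∃ C : ℝ, 0 ≤ C ∧ ∃ S : ℝ → ((Fin d → ℝ) →ᵇ (Fin m → ℝ)) →L[ℝ] ((Fin d → ℝ) →ᵇ (Fin m → ℝ)),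
      ∀ ε > 0, (∀ f, ‖S ε f‖ ≤ C * ‖f‖) ∧ (∀ θ f, S ε (tr _ θ f) = tr _ θ (S ε f)) ∧
        (∀ f ψ t, ∃ x', HasDerivAt (fun t : ℝ => S ε f (ψ + t • ω)) x' t ∧
          Γ.mulVec (S ε f (ψ + t • ω)) + ε • M.mulVec x' = f (ψ + t • ω)) ∧
        (∀ g ℓ, LipW ω g ℓ → ‖S ε g - lft (mcl Γ⁻¹) g‖ ≤ C * ε * ℓ) := by
  obtain ⟨P, N, l, hl, h1, h2, h3⟩ := simul_diag Γ M hΓ hM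
  let C1 := ∑ i, ‖P.col i‖ * ‖colF P i‖
  let C2 := ∑ i, l i * (‖P.col i‖ * ‖colF P i‖)
  have hC1 : 0 ≤ C1 := by positivity
  have hC2 : 0 ≤ C2 := Finset.sum_nonneg fun i _ => mul_nonneg (hl i).le (by positivity)
  refine ⟨C1 + C2, by positivity,
    fun ε => op ω (fun i => ε * l i) P.col (colF P), fun ε hε => ⟨?_, ?_, ?_, ?_⟩⟩
  · intro f
    refine (op_norm ω _ _ _ f).trans ?_
    exact mul_le_mul_of_nonneg_right (by linarith) (norm_nonneg _)
  · exact op_tr ω _ _ _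
  · intro f ψ t
    refine ⟨_, op_deriv ω _ _ _ (fun i => mul_pos hε (hl i)) f ψ t, ?_⟩
    rw [op_apply]
    set j : Fin m → ℝ := fun i => J ω (ε * l i) (lft (colF P i) f) (ψ + t • ω)
    set v := f (ψ + t • ω)
    have e1 : ∑ i, J ω (ε * l i) (lft (colF P i) f) (ψ + t • ω) • P.col i = P.mulVec j :=
      sum_smul_col P j
    have e2 : ∑ i, ((colF P i v - J ω (ε * l i) (lft (colF P i) f) (ψ + t • ω)) / (ε * l i))
        • P.col i = P.mulVec (fun i => (P.transpose.mulVec v i - j i) / (ε * l i)) :=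
      sum_smul_col P _
    rw [e1, e2, Matrix.mulVec_mulVec, Matrix.mulVec_mulVec, h1, h2, ← Matrix.mulVec_mulVec,
      ← Matrix.mulVec_smul, ← Matrix.mulVec_add]
    have : j + ε • (Matrix.diagonal l).mulVec
        (fun i => (P.transpose.mulVec v i - j i) / (ε * l i)) = P.transpose.mulVec v := by
      ext i
      have := (hl i).ne'
      simp only [Pi.add_apply, Pi.smul_apply, Matrix.mulVec_diagonal, smul_eq_mul]
      field_simp
      ring
    rw [this, Matrix.mulVec_mulVec, h3, Matrix.one_mulVec]
  · intro g ℓ hg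
    have hl' : 0 ≤ ℓ := by simpa using (norm_nonneg _).trans (hg 1)
    have hi : Γ⁻¹ = P * P.transpose := by
      refine Matrix.inv_eq_right_inv ?_
      rw [← mul_assoc, h1, h3]
    refine (op_close ω _ _ _ (fun i => (mul_pos hε (hl i)).le) g hg (mcl Γ⁻¹) ?_).trans ?_
    · intro v
      rw [hi, mcl_apply, ← Matrix.mulVec_mulVec]
      exact (sum_smul_col P _).symm
    · refine mul_le_mul_of_nonneg_right ?_ hl'
      have : ∑ i, ε * l i * (‖P.col i‖ * ‖colF P i‖) = C2 * ε := by
        simp only [C2]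
        rw [Finset.sum_mul]
        exact Finset.sum_congr rfl fun i _ => by ring
      rw [this]
      nlinarith

theorem exists_G (A Γ : Matrix (Fin m) (Fin m) ℝ) (hA : A.PosDef) (hΓ : Γ.PosDef) :
    ∃ C : ℝ, 0 ≤ C ∧ ∃ G : ℝ → ((Fin d → ℝ) →ᵇ (Fin m → ℝ)) →L[ℝ] ((Fin d → ℝ) →ᵇ (Fin m → ℝ)),
      ∀ ε > 0, (∀ f, ‖G ε f‖ ≤ C * ‖f‖) ∧ (∀ θ f, G ε (tr _ θ f) = tr _ θ (G ε f)) ∧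
        (∀ f ψ t, HasDerivAt (fun t : ℝ => G ε f (ψ + t • ω))
          (ε • (f (ψ + t • ω) - A.mulVec (Γ⁻¹.mulVec (G ε f (ψ + t • ω))))) t) ∧
        (∀ f, LipW ω (G ε f) (C * ε * ‖f‖)) := by
  obtain ⟨Q, N, l, hl, h1, h2, h3⟩ := simul_diag Γ A hΓ hA
  let a : Fin m → Fin m → ℝ := fun i => (l i)⁻¹ • N.col i
  let C1 := ∑ i, ‖a i‖ * ‖colF Q i‖
  let C2 := ∑ i, 2 * l i * (‖a i‖ * ‖colF Q i‖)
  have hC1 : 0 ≤ C1 := by positivity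
  have hC2 : 0 ≤ C2 := Finset.sum_nonneg fun i _ =>
    mul_nonneg (mul_nonneg (by norm_num) (hl i).le) (by positivity)
  have hpos : ∀ ε > 0, ∀ i, 0 < (ε * l i)⁻¹ := fun ε hε i => inv_pos.2 (mul_pos hε (hl i))
  have hi : Γ⁻¹ = Q * Q.transpose := by
    refine Matrix.inv_eq_right_inv ?_
    rw [← mul_assoc, h1, h3]
  have h3' : Q.transpose * N = 1 := mul_eq_one_comm.1 h3
  refine ⟨C1 + C2, by positivity,
    fun ε => op ω (fun i => (ε * l i)⁻¹) a (colF Q), fun ε hε => ⟨?_, ?_, ?_, ?_⟩⟩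
  · intro f
    refine (op_norm ω _ _ _ f).trans ?_
    exact mul_le_mul_of_nonneg_right (by linarith) (norm_nonneg _)
  · exact op_tr ω _ _ _
  · intro f ψ t
    refine (op_deriv ω _ _ _ (hpos ε hε) f ψ t).congr_deriv ?_
    rw [op_apply]
    set j : Fin m → ℝ := fun i => J ω (ε * l i)⁻¹ (lft (colF Q i) f) (ψ + t • ω)
    set v := f (ψ + t • ω)
    have e1 : ∑ i, J ω (ε * l i)⁻¹ (lft (colF Q i) f) (ψ + t • ω) • a i =
        N.mulVec (fun i => j i * (l i)⁻¹) := by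
      rw [← sum_smul_col]
      exact Finset.sum_congr rfl fun i _ => by rw [mul_smul]
    have e2 : ∑ i, ((colF Q i v - J ω (ε * l i)⁻¹ (lft (colF Q i) f) (ψ + t • ω)) / (ε * l i)⁻¹)
        • a i = N.mulVec (ε • (Q.transpose.mulVec v - j)) := by
      rw [← sum_smul_col]
      refine Finset.sum_congr rfl fun i _ => ?_
      simp only [a]
      rw [smul_smul]
      congr 1
      have := (hl i).ne'
      simp only [Pi.smul_apply, Pi.sub_apply, colF_apply, smul_eq_mul, j]
      field_simp
    rw [e1, e2, hi, Matrix.mulVec_smul, Matrix.mulVec_sub, Matrix.mulVec_mulVec, h3,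
      Matrix.one_mulVec]
    congr 2
    have e3 : A * (Q * Q.transpose) * N = N * Matrix.diagonal l := by
      rw [mul_assoc, mul_assoc, h3', mul_one, h2]
    rw [Matrix.mulVec_mulVec, Matrix.mulVec_mulVec, e3, ← Matrix.mulVec_mulVec]
    congr 1
    ext i
    have := (hl i).ne'
    rw [Matrix.mulVec_diagonal]
    field_simp
  · intro f
    intro t
    refine (op_lip ω _ _ _ (hpos ε hε) f t).trans ?_
    refine mul_le_mul_of_nonneg_right (mul_le_mul_of_nonneg_right ?_ (norm_nonneg _)) (abs_nonneg _)
    have : ∑ i, 2 / (ε * l i)⁻¹ * (‖a i‖ * ‖colF Q i‖) = C2 * ε := by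
      simp only [C2]
      rw [Finset.sum_mul]
      exact Finset.sum_congr rfl fun i _ => by rw [div_inv_eq_mul]; ring
    rw [this]
    nlinarith

end OpSec

end Part5

section Part6

open BoundedContinuousFunction MeasureTheory

section ZM
variable {d m : ℕ}

/-- the fundamental cell -/
abbrev box (d : ℕ) : Set (Fin d → ℝ) := Set.univ.pi fun _ : Fin d => Set.Icc (0 : ℝ) (2 * π)

theorem box_vol : (volume (box d)).toReal = (2 * π) ^ d := by
  have : box d = Set.Icc (0 : Fin d → ℝ) (fun _ => 2 * π) := by
    rw [← Set.pi_univ_Icc]; rfl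
  rw [this, Real.volume_Icc_pi_toReal (a := 0) (fun _ => Real.two_pi_pos.le)]
  simp

theorem box_vol_lt : volume (box d) < ⊤ :=
  (isCompact_univ_pi fun _ => isCompact_Icc).measure_lt_top

theorem box_int (f : (Fin d → ℝ) →ᵇ ℝ) : IntegrableOn f (box d) :=
  f.continuous.continuousOn.integrableOn_compact (isCompact_univ_pi fun _ => isCompact_Icc)

/-- the mean -/
def mean (d : ℕ) : ((Fin d → ℝ) →ᵇ ℝ) →L[ℝ] ℝ :=
  LinearMap.mkContinuous
    { toFun := fun f => ((2 * π)⁻¹ ^ d) * ∫ ψ in box d, f ψ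
      map_add' := fun f g => by
        simp only [BoundedContinuousFunction.coe_add, Pi.add_apply]
        rw [integral_add (box_int f) (box_int g), mul_add]
      map_smul' := fun a f => by
        simp only [BoundedContinuousFunction.coe_smul, smul_eq_mul, RingHom.id_apply]
        rw [integral_const_mul]; ring } 1 (fun f => by
      have hp := Real.two_pi_pos
      have h := norm_setIntegral_le_of_norm_le_const (μ := volume) (s := box d) (f := f)
        (C := ‖f‖) box_vol_lt (fun x _ => f.norm_coe_le_norm x)
      simp only [LinearMap.coe_mk, AddHom.coe_mk, Measure.real, box_vol] at h ⊢
      rw [norm_mul, Real.norm_of_nonneg (by positivity), one_mul]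
      calc _ ≤ (2 * π)⁻¹ ^ d * (‖f‖ * (2 * π) ^ d) :=
            mul_le_mul_of_nonneg_left h (by positivity)
        _ = ‖f‖ := by
            rw [mul_comm ‖f‖, ← mul_assoc, ← mul_pow, inv_mul_cancel₀ hp.ne', one_pow, one_mul])

theorem mean_apply (f : (Fin d → ℝ) →ᵇ ℝ) : mean d f = ((2 * π)⁻¹ ^ d) * ∫ ψ in box d, f ψ := rfl

theorem mean_const (a : ℝ) : mean d (constL _ ℝ a) = a := by
  have hp := Real.two_pi_pos
  rw [mean_apply]
  simp only [constL_apply]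
  rw [setIntegral_const, Measure.real, box_vol, smul_eq_mul, ← mul_assoc, ← mul_pow,
    inv_mul_cancel₀ hp.ne', one_pow, one_mul]

/-- projection to the torus -/
def tor (ψ : Fin d → ℝ) : UnitAddTorus (Fin d) := fun j => ((ψ j / (2 * π) : ℝ) : UnitAddCircle)

theorem tor_cont : Continuous (tor : (Fin d → ℝ) → UnitAddTorus (Fin d)) := by
  unfold tor
  refine continuous_pi fun j => ?_
  exact (AddCircle.continuous_mk' 1).comp (by fun_prop)

/-- pullback from torus, real part -/
def toY : C(UnitAddTorus (Fin d), ℂ) →L[ℝ] ((Fin d → ℝ) →ᵇ ℝ) :=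
  LinearMap.mkContinuous
    { toFun := fun φ => BoundedContinuousFunction.ofNormedAddCommGroup (fun ψ => (φ (tor ψ)).re)
        (Complex.continuous_re.comp (φ.continuous.comp tor_cont)) ‖φ‖
        (fun ψ => (Complex.abs_re_le_norm _).trans (φ.norm_coe_le_norm _))
      map_add' := fun f g => by ext ψ; simp
      map_smul' := fun a f => by ext ψ; simp } 1 (fun φ => by
        rw [one_mul]
        exact (BoundedContinuousFunction.norm_le (norm_nonneg _)).2
          (fun ψ => (Complex.abs_re_le_norm _).trans (φ.norm_coe_le_norm _)))

theorem toY_apply (φ : C(UnitAddTorus (Fin d), ℂ)) (ψ) : toY φ ψ = (φ (tor ψ)).re := rfl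

theorem exists_lift (b : (Fin d → ℝ) →ᵇ ℝ) (hb : ∀ ψ k, b (ψ + per k) = b ψ) :
    ∃ φ, toY φ = b := by
  have hq : IsOpenQuotientMap (fun (x : Fin d → ℝ) (j : Fin d) => ((x j : ℝ) : UnitAddCircle)) :=
    IsOpenQuotientMap.piMap (fun _ => QuotientAddGroup.isOpenQuotientMap_mk)
  let r : UnitAddTorus (Fin d) → (Fin d → ℝ) := Function.surjInv hq.surjective
  have hr : ∀ y, (fun j => ((r y j : ℝ) : UnitAddCircle)) = y := Function.surjInv_eq hq.surjective
  have key : ∀ x : Fin d → ℝ, b (fun j => 2 * π * r (fun j => (x j : UnitAddCircle)) j) =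
      b (fun j => 2 * π * x j) := by
    intro x
    have h1 : ∀ j, ∃ k : ℤ, r (fun j => (x j : UnitAddCircle)) j = x j + k := by
      intro j
      have h2 := congrFun (hr (fun j => (x j : UnitAddCircle))) j
      have h3 := (QuotientAddGroup.eq.1 h2.symm)
      obtain ⟨k, hk⟩ := AddSubgroup.mem_zmultiples_iff.1 h3
      refine ⟨k, ?_⟩
      simp at hk
      linarith
    choose k hk using h1
    rw [← hb (fun j => 2 * π * x j) k]
    congr 1
    ext j
    simp only [hk, per, Pi.add_apply]; ring
  have hc : Continuous (fun y : UnitAddTorus (Fin d) => b (fun j => 2 * π * r y j)) := by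
    rw [hq.isQuotientMap.continuous_iff]
    have : (fun y : UnitAddTorus (Fin d) => b (fun j => 2 * π * r y j)) ∘
        (fun (x : Fin d → ℝ) (j : Fin d) => ((x j : ℝ) : UnitAddCircle)) =
        fun x => b (fun j => 2 * π * x j) := by
      ext x; exact key x
    rw [this]
    fun_prop
  refine ⟨⟨fun y => ((b (fun j => 2 * π * r y j) : ℝ) : ℂ), Complex.continuous_ofReal.comp hc⟩, ?_⟩
  ext ψ
  rw [toY_apply]
  simp only [ContinuousMap.coe_mk, Complex.ofReal_re]
  have := key (fun j => ψ j / (2 * π))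
  unfold tor
  rw [this]
  congr 1
  ext j
  field_simp

theorem mFourier_tor (n : Fin d → ℤ) (ψ : Fin d → ℝ) :
    UnitAddTorus.mFourier n (tor ψ) = ∏ j, Complex.exp (Complex.I * n j * ψ j) := by
  simp only [UnitAddTorus.mFourier, ContinuousMap.coe_mk, tor]
  refine Finset.prod_congr rfl fun j _ => ?_
  rw [fourier_coe_apply]
  congr 1
  have : (π : ℂ) ≠ 0 := by exact_mod_cast Real.pi_ne_zero
  push_cast
  field_simp

/-- closed span of coboundaries -/
def cob (ω : Fin d → ℝ) : Submodule ℝ ((Fin d → ℝ) →ᵇ ℝ) :=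
  (Submodule.span ℝ {y | ∃ (s : ℝ) (f : (Fin d → ℝ) →ᵇ ℝ), y = tr ℝ (s • ω) f - f}).topologicalClosure

theorem mean_mode (n : Fin d → ℤ) (hn : n ≠ 0) (z : ℂ) :
    mean d (toY (z • UnitAddTorus.mFourier n)) = 0 := by
  rw [mean_apply]
  have h1 : ∫ ψ in box d, UnitAddTorus.mFourier n (tor ψ) = 0 := by
    simp only [mFourier_tor]
    rw [volume_pi, Measure.restrict_pi_pi,
      integral_fintype_prod_eq_prod (𝕜 := ℂ) (fun j (x : ℝ) => Complex.exp (Complex.I * n j * x))]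
    obtain ⟨j, hj⟩ := Function.ne_iff.1 hn
    refine Finset.prod_eq_zero (Finset.mem_univ j) ?_
    have hj' : (n j : ℂ) ≠ 0 := by simpa using hj
    rw [integral_Icc_eq_integral_Ioc, ← intervalIntegral.integral_of_le Real.two_pi_pos.le,
      integral_exp_mul_complex (mul_ne_zero Complex.I_ne_zero hj')]
    have : Complex.exp (Complex.I * n j * ((2 * π : ℝ) : ℂ)) = 1 := by
      rw [Complex.exp_eq_one_iff]
      exact ⟨n j, by push_cast; ring⟩
    rw [this]; simp
  have h2 : ∫ ψ in box d, toY (z • UnitAddTorus.mFourier n) ψ =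
      (z * ∫ ψ in box d, UnitAddTorus.mFourier n (tor ψ)).re := by
    rw [← integral_const_mul]
    have hi : IntegrableOn (fun ψ => z * UnitAddTorus.mFourier n (tor ψ)) (box d) := by
      refine ContinuousOn.integrableOn_compact (isCompact_univ_pi fun _ => isCompact_Icc) ?_
      exact (continuous_const.mul
        ((UnitAddTorus.mFourier n).continuous.comp tor_cont)).continuousOn
    exact integral_re hi
  rw [h2, h1]; simp

theorem mode_cob (ω : Fin d → ℝ) (hω : ∀ ν : Fin d → ℤ, ν ≠ 0 → (∑ j, ω j * ν j) ≠ 0)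
    (n : Fin d → ℤ) (hn : n ≠ 0) (z : ℂ) : toY (z • UnitAddTorus.mFourier n) ∈ cob ω := by
  set g := toY (z • UnitAddTorus.mFourier n) with hg
  have h0 := hω n hn
  have h : tr ℝ ((π / ∑ j, ω j * n j) • ω) g = -g := by
    ext ψ
    simp only [tr_apply, hg, BoundedContinuousFunction.neg_apply, toY_apply,
      ContinuousMap.smul_apply, smul_eq_mul]
    rw [← Complex.neg_re, ← mul_neg]
    congr 2
    rw [mFourier_tor, mFourier_tor, ← Complex.exp_sum, ← Complex.exp_sum, ← mul_neg_one,
      ← Complex.exp_pi_mul_I, ← Complex.exp_add]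
    congr 1
    have : (π : ℂ) = (π / ∑ j, ω j * n j : ℝ) * ((∑ j, ω j * n j : ℝ) : ℂ) := by
      rw [← Complex.ofReal_mul, div_mul_cancel₀ _ h0]
    conv_rhs => rw [this]
    push_cast
    rw [Finset.mul_sum, Finset.sum_mul, ← Finset.sum_add_distrib]
    refine Finset.sum_congr rfl fun j _ => ?_
    simp only [Pi.add_apply, Pi.smul_apply, smul_eq_mul]
    push_cast
    ring
  have h2 : g = (-(1/2) : ℝ) • (tr ℝ ((π / ∑ j, ω j * n j) • ω) g - g) := by
    rw [h]; ext ψ; simp; ring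
  rw [h2]
  exact Submodule.smul_mem _ _ (Submodule.le_topologicalClosure _ (Submodule.subset_span ⟨_, g, rfl⟩))

theorem mem_cob (ω : Fin d → ℝ) (hω : ∀ ν : Fin d → ℤ, ν ≠ 0 → (∑ j, ω j * ν j) ≠ 0)
    (b : (Fin d → ℝ) →ᵇ ℝ) (hb : ∀ ψ k, b (ψ + per k) = b ψ) (hm : mean d b = 0) : b ∈ cob ω := by
  let D : ((Fin d → ℝ) →ᵇ ℝ) →L[ℝ] ((Fin d → ℝ) →ᵇ ℝ) :=
    ContinuousLinearMap.id ℝ _ - (constL _ ℝ).comp (mean d)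
  let Kz : Submodule ℂ C(UnitAddTorus (Fin d), ℂ) :=
    { carrier := {φ | ∀ z : ℂ, D (toY (z • φ)) ∈ cob ω}
      add_mem' := fun {x y} hx hy z => by
        have e : z • (x + y) = z • x + z • y := by ext; simp [mul_add]
        rw [e, map_add, map_add]; exact Submodule.add_mem _ (hx z) (hy z)
      zero_mem' := fun z => by rw [smul_zero, map_zero, map_zero]; exact Submodule.zero_mem _
      smul_mem' := fun c x hx z => by rw [smul_smul]; exact hx _ }
  have hcl : IsClosed (Kz : Set C(UnitAddTorus (Fin d), ℂ)) := by
    have : (Kz : Set C(UnitAddTorus (Fin d), ℂ)) = ⋂ z : ℂ, {φ | D (toY (z • φ)) ∈ cob ω} := by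
      ext φ; simp [Kz]
    rw [this]
    refine isClosed_iInter fun z => ?_
    have hc : IsClosed (cob ω : Set ((Fin d → ℝ) →ᵇ ℝ)) :=
      Submodule.isClosed_topologicalClosure _
    exact hc.preimage (D.continuous.comp (toY.continuous.comp (continuous_const_smul z)))
  have hle : Submodule.span ℂ (Set.range (UnitAddTorus.mFourier (d := Fin d))) ≤ Kz := by
    rw [Submodule.span_le]
    rintro _ ⟨n, rfl⟩ z
    by_cases hn : n = 0
    · subst hn
      have : toY (z • UnitAddTorus.mFourier (0 : Fin d → ℤ)) = constL _ ℝ z.re := by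
        ext ψ; simp [toY_apply, UnitAddTorus.mFourier_zero]
      rw [this]
      have h0 : D (constL _ ℝ z.re) = 0 := by
        simp only [D, _root_.sub_apply, ContinuousLinearMap.comp_apply, mean_const]
        simp
      rw [h0]; exact Submodule.zero_mem _
    · have h0 : D (toY (z • UnitAddTorus.mFourier n)) = toY (z • UnitAddTorus.mFourier n) := by
        simp only [D, _root_.sub_apply, ContinuousLinearMap.comp_apply,
          mean_mode n hn z]
        simp
      rw [h0]
      exact mode_cob ω hω n hn z
  have htop : Kz = ⊤ := by
    rw [eq_top_iff, ← UnitAddTorus.span_mFourier_closure_eq_top]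
    exact Submodule.topologicalClosure_minimal _ hle hcl
  obtain ⟨φ, rfl⟩ := exists_lift b hb
  have h1 : φ ∈ Kz := by rw [htop]; trivial
  have h2 := h1 1
  rw [one_smul] at h2
  have h3 : D (toY φ) = toY φ := by
    simp only [D, _root_.sub_apply, ContinuousLinearMap.comp_apply, hm]
    simp
  rwa [h3] at h2

/-- pointwise multiplication -/
def sm (b : (Fin d → ℝ) →ᵇ ℝ) (g : (Fin d → ℝ) →ᵇ (Fin m → ℝ)) : (Fin d → ℝ) →ᵇ (Fin m → ℝ) :=
  BoundedContinuousFunction.ofNormedAddCommGroup (fun ψ => b ψ • g ψ) (by fun_prop) (‖b‖ * ‖g‖)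
    (fun ψ => by
      rw [norm_smul]
      exact mul_le_mul (b.norm_coe_le_norm ψ) (g.norm_coe_le_norm ψ) (norm_nonneg _) (norm_nonneg _))

@[simp] theorem sm_apply (b : (Fin d → ℝ) →ᵇ ℝ) (g : (Fin d → ℝ) →ᵇ (Fin m → ℝ)) (ψ) :
    sm b g ψ = b ψ • g ψ := rfl

theorem sm_norm_le (b : (Fin d → ℝ) →ᵇ ℝ) (g : (Fin d → ℝ) →ᵇ (Fin m → ℝ)) :
    ‖sm b g‖ ≤ ‖b‖ * ‖g‖ :=
  (BoundedContinuousFunction.norm_le (by positivity)).2 fun ψ => by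
    rw [sm_apply, norm_smul]
    exact mul_le_mul (b.norm_coe_le_norm ψ) (g.norm_coe_le_norm ψ) (norm_nonneg _) (norm_nonneg _)

theorem sm_add (b b' : (Fin d → ℝ) →ᵇ ℝ) (g : (Fin d → ℝ) →ᵇ (Fin m → ℝ)) :
    sm (b + b') g = sm b g + sm b' g := by
  ext ψ i; simp [add_mul]

theorem key_lemma (ω : Fin d → ℝ) (b : (Fin d → ℝ) →ᵇ ℝ) (hb : b ∈ cob ω)
    {C : ℝ} (hC : 0 ≤ C)
    (G : ℝ → ((Fin d → ℝ) →ᵇ (Fin m → ℝ)) →L[ℝ] ((Fin d → ℝ) →ᵇ (Fin m → ℝ)))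
    (hG1 : ∀ ε > 0, ∀ f, ‖G ε f‖ ≤ C * ‖f‖)
    (hG2 : ∀ ε > 0, ∀ θ f, G ε (tr _ θ f) = tr _ θ (G ε f))
    (hG3 : ∀ ε > 0, ∀ f, LipW ω (G ε f) (C * ε * ‖f‖)) (η : ℝ) (hη : 0 < η) :
    ∃ C', 0 ≤ C' ∧ ∀ ε > 0, ∀ g ℓ, LipW ω g ℓ →
      ‖G ε (sm b g)‖ ≤ η * ‖g‖ + C' * (ε * ‖g‖ + ℓ) := by
  have hspan : ∀ b ∈ Submodule.span ℝ
      {y | ∃ (s : ℝ) (f : (Fin d → ℝ) →ᵇ ℝ), y = tr ℝ (s • ω) f - f},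
      ∃ C', 0 ≤ C' ∧ ∀ ε > 0, ∀ g ℓ, LipW ω g ℓ →
        ‖G ε (sm b g)‖ ≤ C' * (ε * ‖g‖ + ℓ) := by
    intro b hb
    induction hb using Submodule.span_induction with
    | mem y hy =>
      obtain ⟨s, f, rfl⟩ := hy
      refine ⟨C * ‖f‖ * |s|, by positivity, fun ε hε g ℓ hg => ?_⟩
      have e : sm (tr ℝ (s • ω) f - f) g =
          (tr _ (s • ω) (sm f g) - sm f g) - sm (tr ℝ (s • ω) f) (tr _ (s • ω) g - g) := by
        ext ψ i
        simp
        ring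
      rw [e, map_sub, map_sub, hG2 ε hε]
      have h1 := hG3 ε hε (sm f g) s
      have h2 := hG1 ε hε (sm (tr ℝ (s • ω) f) (tr _ (s • ω) g - g))
      have h3 : ‖sm f g‖ ≤ ‖f‖ * ‖g‖ := sm_norm_le f g
      have h4 : ‖sm (tr ℝ (s • ω) f) (tr _ (s • ω) g - g)‖ ≤ ‖f‖ * (ℓ * |s|) :=
        (sm_norm_le _ _).trans (mul_le_mul (tr_norm_le _ _) (hg s) (norm_nonneg _) (norm_nonneg _))
      refine (norm_sub_le _ _).trans ?_
      calc _ ≤ C * ε * (‖f‖ * ‖g‖) * |s| + C * (‖f‖ * (ℓ * |s|)) := by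
            refine add_le_add (h1.trans ?_) (h2.trans ?_)
            · gcongr
            · gcongr
        _ = _ := by ring
    | zero =>
      refine ⟨0, le_rfl, fun ε hε g ℓ hg => ?_⟩
      have : sm 0 g = 0 := by ext ψ i; simp
      rw [this]; simp
    | add x y _ _ hx hy =>
      obtain ⟨C1, h1, hx⟩ := hx
      obtain ⟨C2, h2, hy⟩ := hy
      refine ⟨C1 + C2, by positivity, fun ε hε g ℓ hg => ?_⟩
      rw [sm_add, map_add, add_mul]
      exact (norm_add_le _ _).trans (add_le_add (hx ε hε g ℓ hg) (hy ε hε g ℓ hg))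
    | smul a x _ hx =>
      obtain ⟨C1, h1, hx⟩ := hx
      refine ⟨|a| * C1, by positivity, fun ε hε g ℓ hg => ?_⟩
      have e : sm (a • x) g = a • (sm x g) := by
        ext ψ i
        simp [mul_assoc]
      rw [e, map_smul, norm_smul, mul_assoc]
      exact mul_le_mul_of_nonneg_left (hx ε hε g ℓ hg) (abs_nonneg _)
  obtain ⟨b', hb', hd⟩ := Metric.mem_closure_iff.1 hb (η / (C + 1)) (by positivity)
  obtain ⟨C', hC', h⟩ := hspan b' hb'
  refine ⟨C', hC', fun ε hε g ℓ hg => ?_⟩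
  have e : sm b g = sm (b - b') g + sm b' g := by rw [← sm_add, sub_add_cancel]
  rw [e, map_add]
  refine (norm_add_le _ _).trans (add_le_add ?_ (h ε hε g ℓ hg))
  refine (hG1 ε hε _).trans ?_
  have h1 : ‖sm (b - b') g‖ ≤ ‖b - b'‖ * ‖g‖ := sm_norm_le _ _
  rw [dist_eq_norm] at hd
  calc _ ≤ C * (η / (C + 1) * ‖g‖) := by gcongr; exact h1.trans (by gcongr)
    _ = (C / (C + 1)) * η * ‖g‖ := by ring
    _ ≤ 1 * η * ‖g‖ := by
      gcongr
      rw [div_le_one (by positivity)]; linarith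
    _ = _ := by ring

end ZM

end Part6

section Part7

open BoundedContinuousFunction MeasureTheory


section Avg
variable {d m : ℕ} {V W : Type*} [NormedAddCommGroup V] [NormedSpace ℝ V] [FiniteDimensional ℝ V]
  [NormedAddCommGroup W] [NormedSpace ℝ W] [CompleteSpace W]

theorem nem_fderiv_apply {f : V × (Fin d → ℝ) → W} (hf : AnPer f)
    (p q : (Fin d → ℝ) × ((Fin d → ℝ) →ᵇ V)) (ψ : Fin d → ℝ) :
    fderiv ℝ (nem f) p q ψ = fderiv ℝ f (p.2 ψ, ψ + p.1) (q.2 ψ, q.1) := by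
  have h1 : HasFDerivAt (nem f) (fderiv ℝ (nem f) p) p :=
    (nem_analytic hf p).differentiableAt.hasFDerivAt
  have h2 : HasFDerivAt (fun p => nem f p ψ)
      ((BoundedContinuousFunction.evalCLM ℝ ψ).comp (fderiv ℝ (nem f) p)) p :=
    ((BoundedContinuousFunction.evalCLM ℝ ψ : ((Fin d → ℝ) →ᵇ W) →L[ℝ] W).hasFDerivAt).comp p h1
  let Lg : (Fin d → ℝ) × ((Fin d → ℝ) →ᵇ V) →L[ℝ] V × (Fin d → ℝ) :=
    ((BoundedContinuousFunction.evalCLM ℝ ψ).comp (ContinuousLinearMap.snd ℝ _ _)).prod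
      (ContinuousLinearMap.fst ℝ _ _)
  have h3 : HasFDerivAt (fun q : (Fin d → ℝ) × ((Fin d → ℝ) →ᵇ V) => (0, ψ) + Lg q) Lg p :=
    (Lg.hasFDerivAt).const_add (c := (0, ψ))
  have e : ∀ q : (Fin d → ℝ) × ((Fin d → ℝ) →ᵇ V), (0, ψ) + Lg q = (q.2 ψ, ψ + q.1) := by
    intro q; simp [Lg]
  have h4 : HasFDerivAt (fun p => nem f p ψ) ((fderiv ℝ f (p.2 ψ, ψ + p.1)).comp Lg) p := by
    have h5 : HasFDerivAt f (fderiv ℝ f (p.2 ψ, ψ + p.1)) ((0, ψ) + Lg p) := by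
      rw [e]
      exact (hf.an _ (Set.mem_univ _)).differentiableAt.hasFDerivAt
    have h6 := h5.comp p h3
    refine h6.congr_of_eventuallyEq (Eventually.of_forall fun q => ?_)
    simp only [Function.comp_apply]
    rw [e, nem_apply hf]
  have := congrArg (fun T => T q) (h2.unique h4)
  exact this

theorem AnPer.dir {f : V × (Fin d → ℝ) → W} (hf : AnPer f) (v : V × (Fin d → ℝ)) :
    AnPer (fun z => fderiv ℝ f z v) where
  an := fun z hz => by
    have h1 : AnalyticAt ℝ (fderiv ℝ f) z := (hf.an z hz).fderiv
    exact AnalyticAt.fun_comp (f := fderiv ℝ f)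
      (g := fun T => ContinuousLinearMap.apply ℝ W v T)
      ((ContinuousLinearMap.apply ℝ W v).analyticAt _) h1
  per := fun x ψ k => by
    have h2 : (fun z => f (z + ((0 : V), _root_.per k))) = f := by
      ext ⟨x, ψ⟩
      simpa using hf.per x ψ k
    have h3 := fderiv_comp_add_right (𝕜 := ℝ) (f := f) (x := (x, ψ)) ((0 : V), _root_.per k)
    rw [h2] at h3
    rw [h3]; simp

/-- averaged function -/
def avg (f : V × (Fin d → ℝ) → ℝ) (x : V) : ℝ := mean d (nem f (0, constL _ V x))

theorem avg_analytic {f : V × (Fin d → ℝ) → ℝ} (hf : AnPer f) (x : V) : AnalyticAt ℝ (avg f) x := by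
  have h1 : AnalyticAt ℝ (fun x : V => ((0 : Fin d → ℝ), constL (Fin d → ℝ) V x)) x :=
    analyticAt_const.prod ((constL (Fin d → ℝ) V).analyticAt x)
  have h2 : AnalyticAt ℝ (fun x : V => nem f (0, constL (Fin d → ℝ) V x)) x :=
    AnalyticAt.fun_comp (f := fun x : V => ((0 : Fin d → ℝ), constL (Fin d → ℝ) V x))
      (nem_analytic hf _) h1
  exact AnalyticAt.fun_comp (f := fun x : V => nem f (0, constL (Fin d → ℝ) V x))
    (g := fun y => mean d y) ((mean d).analyticAt _) h2

theorem avg_fderiv {f : V × (Fin d → ℝ) → ℝ} (hf : AnPer f) (x v : V) :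
    fderiv ℝ (avg f) x v = avg (fun z => fderiv ℝ f z (v, 0)) x := by
  have h1 : HasFDerivAt (fun x : V => ((0 : Fin d → ℝ), constL (Fin d → ℝ) V x))
      ((0 : V →L[ℝ] (Fin d → ℝ)).prod (constL (Fin d → ℝ) V)) x :=
    (hasFDerivAt_const _ _).prodMk ((constL (Fin d → ℝ) V).hasFDerivAt)
  have h2 := (nem_analytic hf (0, constL (Fin d → ℝ) V x)).differentiableAt.hasFDerivAt
  have h3 := ((mean d).hasFDerivAt.comp x (h2.comp x h1)).fderiv
  have h4 : fderiv ℝ (avg f) x = _ := h3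
  rw [h4]
  show mean d (fderiv ℝ (nem f) (0, constL (Fin d → ℝ) V x) (0, constL (Fin d → ℝ) V v)) =
    mean d (nem _ _)
  congr 1
  ext ψ
  rw [nem_fderiv_apply hf, nem_apply (hf.dir _)]
  rfl

theorem avg_second {f : V × (Fin d → ℝ) → ℝ} (hf : AnPer f) (x v w : V) :
    iteratedFDeriv ℝ 2 (avg f) x ![v, w] =
      avg (fun z => fderiv ℝ (fun z => fderiv ℝ f z (w, 0)) z (v, 0)) x := by
  rw [iteratedFDeriv_two_apply]
  simp only [Matrix.cons_val_zero, Matrix.cons_val_one]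
  rw [← avg_fderiv (hf.dir _)]
  have h1 : avg (fun z => fderiv ℝ f z (w, 0)) = fun x => fderiv ℝ (avg f) x w := by
    ext x; rw [avg_fderiv hf]
  rw [h1]
  have hd : DifferentiableAt ℝ (fderiv ℝ (avg f)) x := (avg_analytic hf x).fderiv.differentiableAt
  rw [fderiv_clm_apply hd (differentiableAt_const w)]
  simp

theorem setup (Vt : (Fin m → ℝ) × (Fin d → ℝ) → ℝ) (hVt : AnalyticOnNhd ℝ Vt Set.univ)
    (hVtper : ∀ (x : Fin m → ℝ) (ψ : Fin d → ℝ) (k : Fin d → ℤ),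
      Vt (x, fun j => ψ j + 2 * π * k j) = Vt (x, ψ))
    (h : (Fin m → ℝ) → (Fin d → ℝ) → (Fin m → ℝ))
    (hh : ∀ x ψ i, h x ψ i = fderiv ℝ (fun y => Vt (y, ψ)) x (Pi.single i 1))
    (Vt₀ : (Fin m → ℝ) → ℝ)
    (hVt₀ : ∀ x, Vt₀ x =
      ((2 * π)⁻¹ ^ d) *
        ∫ ψ in Set.univ.pi fun _ : Fin d => Set.Icc (0 : ℝ) (2 * π), Vt (x, ψ))
    (c : Fin m → ℝ)
    (hcrit : ∀ i, fderiv ℝ Vt₀ c (Pi.single i 1) = 0) :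
    ∃ f : (Fin m → ℝ) × (Fin d → ℝ) → (Fin m → ℝ), (∀ z, f z = h (c + z.1) z.2) ∧ AnPer f ∧
      (∀ i, mean d (lft (ContinuousLinearMap.proj i) (nem f (0, 0))) = 0) ∧
      (∀ i j, mean d (lft (ContinuousLinearMap.proj j)
        (nem (fun z => fderiv ℝ f z (Pi.single i 1, 0)) (0, 0))) =
          hessianMatrix m Vt₀ c i j) := by
  let Vc : (Fin m → ℝ) × (Fin d → ℝ) → ℝ := fun z => Vt ((c, 0) + z)
  have hVc : AnPer Vc := by
    refine ⟨fun z _ => ?_, fun x ψ k => ?_⟩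
    · exact AnalyticAt.fun_comp (f := fun z => (c, (0 : Fin d → ℝ)) + z) (hVt _ (Set.mem_univ _))
        (analyticAt_const.add analyticAt_id)
    · simp only [Vc, Prod.mk_add_mk, zero_add]
      exact hVtper _ _ _
  let f : (Fin m → ℝ) × (Fin d → ℝ) → (Fin m → ℝ) := fun z i =>
    fderiv ℝ Vc z (Pi.single i 1, 0)
  have hfi : ∀ i, AnPer (fun z => fderiv ℝ Vc z ((Pi.single i 1 : Fin m → ℝ), 0)) :=
    fun i => hVc.dir _
  have hf : AnPer f := by
    refine ⟨fun z hz => ?_, fun x ψ k => ?_⟩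
    · exact AnalyticAt.pi fun i => (hfi i).an z hz
    · ext i; exact (hfi i).per x ψ k
  have havg : avg Vc = fun x => Vt₀ (c + x) := by
    ext x
    rw [hVt₀]
    show mean d _ = _
    rw [mean_apply]
    congr 2
    ext ψ
    rw [nem_apply hVc]
    simp [Vc]
  refine ⟨f, ?_, hf, ?_, ?_⟩
  · rintro ⟨x, ψ⟩
    ext i
    rw [hh]
    simp only [f]
    have h1 := fderiv_comp_add_left (𝕜 := ℝ) (f := Vt) (x := (x, ψ)) (c, (0 : Fin d → ℝ))
    have h2 : fderiv ℝ Vc (x, ψ) = fderiv ℝ Vt (c + x, ψ) := by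
      rw [show fderiv ℝ Vc (x, ψ) = _ from h1]; simp
    rw [h2]
    have h3 : HasFDerivAt (fun y : Fin m → ℝ => (y, ψ))
        ((ContinuousLinearMap.id ℝ (Fin m → ℝ)).prod 0) (c + x) :=
      (hasFDerivAt_id _).prodMk (hasFDerivAt_const _ _)
    have h4 := ((hVt (c + x, ψ) (Set.mem_univ _)).differentiableAt.hasFDerivAt.comp (c + x) h3).fderiv
    rw [show fderiv ℝ (fun y => Vt (y, ψ)) (c + x) = _ from h4]
    rfl
  · intro i
    have h1 : avg (fun z => fderiv ℝ Vc z ((Pi.single i 1 : Fin m → ℝ), 0)) 0 = 0 := by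
      rw [← avg_fderiv hVc, havg, fderiv_comp_add_left]
      simpa using hcrit i
    rw [← h1]
    show mean d _ = mean d _
    congr 1
    ext ψ
    rw [nem_apply (hfi i)]
    show (nem f (0, 0) ψ) i = _
    rw [nem_apply hf]
    simp [f]
  · intro i j
    have h1 := avg_second hVc 0 (Pi.single i 1 : Fin m → ℝ) (Pi.single j 1)
    rw [havg, iteratedFDeriv_comp_add_left, add_zero] at h1
    show _ = iteratedFDeriv ℝ 2 Vt₀ c ![Pi.single i 1, Pi.single j 1]
    rw [h1]
    show mean d _ = mean d _
    congr 1
    ext ψ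
    rw [nem_apply ((hfi j).dir _)]
    show (nem (fun z => fderiv ℝ f z ((Pi.single i 1 : Fin m → ℝ), 0)) (0, 0) ψ) j = _
    rw [nem_apply (hf.dir _)]
    have h2 : HasFDerivAt f (fderiv ℝ f (0, ψ)) (0, ψ) :=
      (hf.an _ (Set.mem_univ _)).differentiableAt.hasFDerivAt
    have h3 := (hasFDerivAt_pi'.1 h2 j).fderiv
    have h4 : fderiv ℝ (fun z => fderiv ℝ Vc z ((Pi.single j 1 : Fin m → ℝ), 0)) (0, ψ) = _ := h3
    simp only [add_zero, map_zero, BoundedContinuousFunction.coe_zero, Pi.zero_apply]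
    rw [h4]
    rfl

end Avg

end Part7

section Part8

open BoundedContinuousFunction MeasureTheory

/-- elementary matrix map -/
def Eij {m : ℕ} (i j : Fin m) : (Fin m → ℝ) →L[ℝ] (Fin m → ℝ) :=
  ContinuousLinearMap.smulRight (ContinuousLinearMap.proj i) (Pi.single j (1 : ℝ))

theorem Eij_apply {m : ℕ} (i j : Fin m) (v : Fin m → ℝ) : Eij i j v = v i • Pi.single j (1 : ℝ) :=
  rfl

/-- all data of the abstract problem -/
structure Dat (d m : ℕ) where
  ω : Fin d → ℝ
  M : Matrix (Fin m) (Fin m) ℝ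
  Γ : Matrix (Fin m) (Fin m) ℝ
  A : Matrix (Fin m) (Fin m) ℝ
  hM : M.PosDef
  f : (Fin m → ℝ) × (Fin d → ℝ) → (Fin m → ℝ)
  hf : AnPer f
  mean0 : ∀ i, lft (ContinuousLinearMap.proj i) (nem f (0, 0)) ∈ cob ω
  mean1 : ∀ i j, lft (ContinuousLinearMap.proj j)
        (nem (fun z => fderiv ℝ f z (Pi.single i 1, 0)) (0, 0)) - constL _ ℝ (A j i) ∈ cob ω
  CS : ℝ
  hCS : 0 ≤ CS
  S : ℝ → ((Fin d → ℝ) →ᵇ (Fin m → ℝ)) →L[ℝ] ((Fin d → ℝ) →ᵇ (Fin m → ℝ))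
  S1 : ∀ ε > 0, ∀ f, ‖S ε f‖ ≤ CS * ‖f‖
  S2 : ∀ ε > 0, ∀ θ f, S ε (tr _ θ f) = tr _ θ (S ε f)
  S3 : ∀ ε > 0, ∀ f ψ t, ∃ x', HasDerivAt (fun t : ℝ => S ε f (ψ + t • ω)) x' t ∧
          Γ.mulVec (S ε f (ψ + t • ω)) + ε • M.mulVec x' = f (ψ + t • ω)
  S4 : ∀ ε > 0, ∀ g ℓ, LipW ω g ℓ → ‖S ε g - lft (mcl Γ⁻¹) g‖ ≤ CS * ε * ℓ
  CG : ℝ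
  hCG : 0 ≤ CG
  G : ℝ → ((Fin d → ℝ) →ᵇ (Fin m → ℝ)) →L[ℝ] ((Fin d → ℝ) →ᵇ (Fin m → ℝ))
  G1 : ∀ ε > 0, ∀ f, ‖G ε f‖ ≤ CG * ‖f‖
  G2 : ∀ ε > 0, ∀ θ f, G ε (tr _ θ f) = tr _ θ (G ε f)
  G3 : ∀ ε > 0, ∀ f ψ t, HasDerivAt (fun t : ℝ => G ε f (ψ + t • ω))
          (ε • (f (ψ + t • ω) - A.mulVec (Γ⁻¹.mulVec (G ε f (ψ + t • ω))))) t
  G4 : ∀ ε > 0, ∀ f, LipW ω (G ε f) (CG * ε * ‖f‖)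

namespace Dat
variable {d m : ℕ} (D : Dat d m)

/-- smallness property of averaging -/
def KP (T : ((Fin d → ℝ) →ᵇ (Fin m → ℝ)) → ((Fin d → ℝ) →ᵇ (Fin m → ℝ))) : Prop :=
  ∀ η > 0, ∃ C', 0 ≤ C' ∧ ∀ ε > 0, ∀ g ℓ, LipW D.ω g ℓ →
      ‖D.G ε (T g)‖ ≤ η * ‖g‖ + C' * (ε * ‖g‖ + ℓ)

theorem KP_sm {b} (hb : b ∈ cob D.ω) (B : (Fin m → ℝ) →L[ℝ] (Fin m → ℝ)) :
    D.KP (fun g => sm b (lft B g)) := by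
  intro η hη
  obtain ⟨C', hC', h⟩ := key_lemma D.ω b hb D.hCG D.G D.G1 D.G2 D.G4 (η / (‖B‖ + 1))
    (by positivity)
  refine ⟨C' * ‖B‖, by positivity, fun ε hε g ℓ hg => ?_⟩
  have h1 := h ε hε (lft B g) (‖B‖ * ℓ)
    (hg.map (lft B) (norm_nonneg _) (lft_norm_le B) (lft_tr B))
  have h2 := lft_norm_le B g
  calc _ ≤ _ := h1
    _ ≤ η / (‖B‖ + 1) * (‖B‖ * ‖g‖) + C' * (ε * (‖B‖ * ‖g‖) + ‖B‖ * ℓ) := by gcongr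
    _ = (‖B‖ / (‖B‖ + 1)) * η * ‖g‖ + C' * ‖B‖ * (ε * ‖g‖ + ℓ) := by ring
    _ ≤ 1 * η * ‖g‖ + C' * ‖B‖ * (ε * ‖g‖ + ℓ) := by
      gcongr
      rw [div_le_one (by positivity)]; linarith
    _ = _ := by ring

theorem KP_add {T T'} (h : D.KP T) (h' : D.KP T') : D.KP (fun g => T g + T' g) := by
  intro η hη
  obtain ⟨C1, hC1, h1⟩ := h (η / 2) (by positivity)
  obtain ⟨C2, hC2, h2⟩ := h' (η / 2) (by positivity)
  refine ⟨C1 + C2, by positivity, fun ε hε g ℓ hg => ?_⟩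
  rw [map_add]
  have := norm_add_le (D.G ε (T g)) (D.G ε (T' g))
  have h3 := h1 ε hε g ℓ hg
  have h4 := h2 ε hε g ℓ hg
  linarith

theorem KP_sum {ι : Type*} (s : Finset ι)
    (T : ι → ((Fin d → ℝ) →ᵇ (Fin m → ℝ)) → ((Fin d → ℝ) →ᵇ (Fin m → ℝ)))
    (h : ∀ i, D.KP (T i)) : D.KP (fun g => ∑ i ∈ s, T i g) := by
  classical
  induction s using Finset.induction_on with
  | empty =>
    intro η hη
    refine ⟨0, le_rfl, fun ε hε g ℓ hg => ?_⟩
    simp; positivity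
  | insert i s hi ih =>
    simp only [Finset.sum_insert hi]
    exact D.KP_add (h i) ih

/-- linearisation of the Nemytskii operator -/
def L : ((Fin d → ℝ) →ᵇ (Fin m → ℝ)) →L[ℝ] ((Fin d → ℝ) →ᵇ (Fin m → ℝ)) :=
  (fderiv ℝ (nem D.f) (0, 0)).comp (ContinuousLinearMap.inr ℝ _ _)

theorem L_apply (v ψ) : D.L v ψ = fderiv ℝ D.f (0, ψ) (v ψ, 0) := by
  show fderiv ℝ (nem D.f) (0, 0) (0, v) ψ = _
  rw [nem_fderiv_apply D.hf]; simp

theorem KP_L : D.KP (fun g => D.L g - lft (mcl D.A) g) := by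
  have h := D.KP_sum Finset.univ _ fun i => D.KP_sum Finset.univ _ fun j =>
    D.KP_sm (D.mean1 i j) (Eij i j)
  convert h using 2 with g
  ext ψ k
  simp only [BoundedContinuousFunction.sub_apply, BoundedContinuousFunction.sum_apply, sm_apply,
    Pi.sub_apply, Finset.sum_apply, Pi.smul_apply, L_apply, constL_apply, smul_eq_mul,
    ContinuousLinearMap.compLeftContinuousBounded_apply, mcl_apply, Eij_apply,
    ContinuousLinearMap.proj_apply, nem_apply (D.hf.dir _), BoundedContinuousFunction.coe_zero,
    Pi.zero_apply, add_zero]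
  have e : ((g ψ, 0) : (Fin m → ℝ) × (Fin d → ℝ)) =
      ∑ i, g ψ i • ((Pi.single i 1 : Fin m → ℝ), (0 : Fin d → ℝ)) := by
    refine Prod.ext ?_ ?_
    · rw [Prod.fst_sum]
      simp only [Prod.smul_fst]
      exact pi_eq_sum_univ' (g ψ)
    · rw [Prod.snd_sum]; simp
  rw [e, map_sum]
  simp only [map_smul, Finset.sum_apply, Pi.smul_apply, smul_eq_mul, Matrix.mulVec, dotProduct]
  rw [← Finset.sum_sub_distrib]
  refine Finset.sum_congr rfl fun i _ => ?_
  rw [Finset.sum_eq_single k]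
  · simp; ring
  · intro j _ hj
    simp [Pi.single_apply, hj.symm]
  · simp

theorem small1 (η : ℝ) (hη : 0 < η) :
    ∃ δ > 0, ∀ ε, 0 < ε → ε < δ → ‖D.G ε (nem D.f (0, 0))‖ ≤ η := by
  have h := D.KP_sum Finset.univ _ fun i => D.KP_sm (D.mean0 i) (Eij i i)
  obtain ⟨C', hC', h⟩ := h (η / 2) (by positivity)
  refine ⟨η / (2 * (C' + 1)), by positivity, fun ε hε hε' => ?_⟩
  set g : (Fin d → ℝ) →ᵇ (Fin m → ℝ) := constL _ _ (fun _ => 1) with hg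
  have hg0 : LipW D.ω g 0 := by
    intro t
    have : tr _ (t • D.ω) g - g = 0 := by ext ψ i; simp [hg]
    rw [this]; simp
  have hg1 : ‖g‖ ≤ 1 := by
    refine (BoundedContinuousFunction.norm_le (by norm_num)).2 fun ψ => ?_
    rw [hg, constL_apply]
    exact (pi_norm_le_iff_of_nonneg (by norm_num)).2 fun i => by simp
  have h1 := h ε hε g 0 hg0
  have e : nem D.f (0, 0) = ∑ i, sm (lft (ContinuousLinearMap.proj i) (nem D.f (0, 0)))
      (lft (Eij i i) g) := by
    ext ψ k
    simp only [BoundedContinuousFunction.sum_apply, Finset.sum_apply, sm_apply, Pi.smul_apply,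
      ContinuousLinearMap.compLeftContinuousBounded_apply, Eij_apply,
      ContinuousLinearMap.proj_apply, smul_eq_mul]
    rw [Finset.sum_eq_single k]
    · simp [hg]
    · intro j _ hj
      simp [Pi.single_apply, hj.symm]
    · simp
  replace h1 : ‖D.G ε (nem D.f (0, 0))‖ ≤ η / 2 * ‖g‖ + C' * (ε * ‖g‖ + 0) :=
    (le_of_eq (congrArg (fun z => ‖D.G ε z‖) e)).trans h1
  have h2 : ε * (2 * (C' + 1)) < η := by rwa [lt_div_iff₀ (by positivity)] at hε'
  have h3 : ε * ‖g‖ ≤ ε * 1 := by gcongr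
  have h4 : C' * (ε * ‖g‖ + 0) ≤ C' * (ε * 1 + 0) := by gcongr
  have h5 : η / 2 * ‖g‖ ≤ η / 2 * 1 := by gcongr
  nlinarith

/-- the linear part -/
def K (ε : ℝ) : ((Fin d → ℝ) →ᵇ (Fin m → ℝ)) →L[ℝ] ((Fin d → ℝ) →ᵇ (Fin m → ℝ)) :=
  (D.G ε).comp (D.L.comp (D.S ε) - (lft (mcl D.A)).comp (lft (mcl D.Γ⁻¹)))

theorem K_apply (ε : ℝ) (u) :
    D.K ε u = D.G ε (D.L (D.S ε u) - lft (mcl D.A) (lft (mcl D.Γ⁻¹) u)) := rfl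

/-- bound for the inner operator -/
def kk : ℝ := ‖D.L‖ * D.CS + ‖mcl D.A‖ * ‖mcl D.Γ⁻¹‖

theorem kk_nonneg : 0 ≤ D.kk := by
  have := D.hCS
  unfold kk; positivity

theorem inner_le (ε : ℝ) (hε : 0 < ε) (u) :
    ‖D.L (D.S ε u) - lft (mcl D.A) (lft (mcl D.Γ⁻¹) u)‖ ≤ D.kk * ‖u‖ := by
  refine (norm_sub_le _ _).trans ?_
  have h1 := (D.L.le_opNorm (D.S ε u)).trans
    (mul_le_mul_of_nonneg_left (D.S1 ε hε u) (norm_nonneg _))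
  have h2 := (lft_norm_le (mcl D.A) (lft (mcl D.Γ⁻¹) u)).trans
    (mul_le_mul_of_nonneg_left (lft_norm_le (mcl D.Γ⁻¹) u) (norm_nonneg _))
  unfold kk
  calc _ ≤ _ := add_le_add h1 h2
    _ = _ := by ring

theorem K_norm (ε : ℝ) (hε : 0 < ε) : ‖D.K ε‖ ≤ D.CG * D.kk := by
  have := D.kk_nonneg
  have := D.hCG
  refine ContinuousLinearMap.opNorm_le_bound _ (by positivity) fun u => ?_
  rw [K_apply, mul_assoc]
  exact (D.G1 ε hε _).trans (mul_le_mul_of_nonneg_left (D.inner_le ε hε u) D.hCG)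

theorem small2 (η : ℝ) (hη : 0 < η) :
    ∃ δ > 0, ∀ ε, 0 < ε → ε < δ → ‖D.K ε * D.K ε‖ ≤ η := by
  have hS := D.hCS
  have hG := D.hCG
  have hk := D.kk_nonneg
  set q := D.CS * D.CG * D.kk with hq
  have hq0 : 0 ≤ q := by positivity
  obtain ⟨C', hC', h⟩ := D.KP_L (η / (2 * (q + 1))) (by positivity)
  set R := D.CG * ‖mcl D.A‖ * q + 2 * C' * q with hR
  have hR0 : 0 ≤ R := by positivity
  refine ⟨min 1 (η / (2 * (R + 1))), by positivity, fun ε hε hε' => ?_⟩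
  have hε1 : ε ≤ 1 := (hε'.trans_le (min_le_left _ _)).le
  have hε2 : ε * (2 * (R + 1)) ≤ η := by
    rw [← le_div_iff₀ (by positivity)]
    exact (hε'.trans_le (min_le_right _ _)).le
  refine ContinuousLinearMap.opNorm_le_bound _ hη.le fun w => ?_
  show ‖D.K ε (D.K ε w)‖ ≤ _
  set w' := D.L (D.S ε w) - lft (mcl D.A) (lft (mcl D.Γ⁻¹) w) with hw'
  have hw : ‖w'‖ ≤ D.kk * ‖w‖ := D.inner_le ε hε w
  have e1 : D.K ε w = D.G ε w' := rfl
  set g := D.G ε w' with hg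
  have g1 : ‖g‖ ≤ D.CG * (D.kk * ‖w‖) := (D.G1 ε hε w').trans (by gcongr)
  have g2 : LipW D.ω g (D.CG * ε * ‖w'‖) := D.G4 ε hε w'
  have s1 : ‖D.S ε g‖ ≤ q * ‖w‖ := by
    refine (D.S1 ε hε g).trans ?_
    calc _ ≤ D.CS * (D.CG * (D.kk * ‖w‖)) := by gcongr
      _ = _ := by rw [hq]; ring
  have s2 : LipW D.ω (D.S ε g) (D.CS * (D.CG * ε * ‖w'‖)) :=
    g2.map (D.S ε) D.hCS (D.S1 ε hε) (D.S2 ε hε)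
  have s3 : D.CS * (D.CG * ε * ‖w'‖) ≤ q * ε * ‖w‖ := by
    calc _ ≤ D.CS * (D.CG * ε * (D.kk * ‖w‖)) := by gcongr
      _ = _ := by rw [hq]; ring
  have e2 : D.K ε g = D.G ε (D.L (D.S ε g) - lft (mcl D.A) (D.S ε g)) +
      D.G ε (lft (mcl D.A) (D.S ε g - lft (mcl D.Γ⁻¹) g)) := by
    rw [K_apply, ← map_add, map_sub (lft (mcl D.A))]
    congr 1; abel
  rw [e1, e2]
  have b1 := h ε hε _ _ s2
  have b2 : ‖D.G ε (lft (mcl D.A) (D.S ε g - lft (mcl D.Γ⁻¹) g))‖ ≤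
      D.CG * (‖mcl D.A‖ * (ε * (q * ε * ‖w‖))) := by
    refine (D.G1 ε hε _).trans (mul_le_mul_of_nonneg_left ?_ hG)
    refine (lft_norm_le _ _).trans (mul_le_mul_of_nonneg_left ?_ (norm_nonneg _))
    refine (D.S4 ε hε g _ g2).trans ?_
    calc _ = ε * (D.CS * (D.CG * ε * ‖w'‖)) := by ring
      _ ≤ _ := by gcongr
  have b3 : η / (2 * (q + 1)) * ‖D.S ε g‖ ≤ η / 2 * ‖w‖ := by
    calc _ ≤ η / (2 * (q + 1)) * (q * ‖w‖) := by gcongr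
      _ = (q / (q + 1)) * (η / 2) * ‖w‖ := by field_simp
      _ ≤ 1 * (η / 2) * ‖w‖ := by
        gcongr
        rw [div_le_one (by positivity)]; linarith
      _ = _ := by ring
  have b4 : C' * (ε * ‖D.S ε g‖ + D.CS * (D.CG * ε * ‖w'‖)) ≤ C' * (ε * (q * ‖w‖) + q * ε * ‖w‖) := by
    gcongr
  have b5 : D.CG * (‖mcl D.A‖ * (ε * (q * ε * ‖w‖))) ≤ D.CG * (‖mcl D.A‖ * (1 * (q * ε * ‖w‖))) := by
    gcongr
  refine (norm_add_le _ _).trans ?_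
  have b6 : ε * R * ‖w‖ ≤ η / 2 * ‖w‖ := by
    gcongr
    nlinarith
  have b7 : D.CG * (‖mcl D.A‖ * (1 * (q * ε * ‖w‖))) + C' * (ε * (q * ‖w‖) + q * ε * ‖w‖)
      = ε * R * ‖w‖ := by rw [hR]; ring
  linarith

end Dat

end Part8

section Part9

open BoundedContinuousFunction MeasureTheory

theorem tr_tendsto {d : ℕ} {W : Type*} [NormedAddCommGroup W] [NormedSpace ℝ W]
    (u : (Fin d → ℝ) →ᵇ W) (hu : ∀ k, tr W (per k) u = u) :
    Tendsto (fun θ => tr W θ u) (nhds 0) (nhds u) := by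
  have hpu : ∀ ψ k, u (ψ + per k) = u ψ := fun ψ k => by
    have := DFunLike.congr_fun (hu k) ψ
    simpa using this
  have hK : IsCompact (Metric.cthickening 1
      (Set.univ.pi fun _ : Fin d => Set.Icc (0 : ℝ) (2 * π))) :=
    (isCompact_univ_pi fun _ => isCompact_Icc).cthickening
  have huc := hK.uniformContinuousOn_of_continuous u.continuous.continuousOn
  rw [Metric.tendsto_nhds_nhds]
  intro η hη
  obtain ⟨δ, hδ, h⟩ := Metric.uniformContinuousOn_iff.1 huc (η / 2) (by positivity)
  refine ⟨min δ 1, by positivity, fun θ hθ => ?_⟩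
  rw [dist_zero_right] at hθ
  rw [dist_eq_norm]
  refine lt_of_le_of_lt ?_ (half_lt_self hη)
  refine (BoundedContinuousFunction.norm_le (by positivity)).2 fun ψ => ?_
  obtain ⟨k, hk⟩ := exists_reduce ψ
  have e : (tr W θ u - u) ψ = u (ψ + per k + θ) - u (ψ + per k) := by
    rw [hpu, add_right_comm, hpu]; rfl
  rw [e, ← dist_eq_norm]
  have hd : dist (ψ + per k + θ) (ψ + per k) = ‖θ‖ := by simp [dist_eq_norm]
  refine (h _ ?_ _ ?_ ?_).le
  · refine Metric.mem_cthickening_of_dist_le _ _ _ _ hk ?_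
    rw [hd]; exact (hθ.trans_le (min_le_right _ _)).le
  · exact Metric.self_subset_cthickening _ hk
  · rw [hd]; exact hθ.trans_le (min_le_left _ _)

namespace Dat
variable {d m : ℕ} (D : Dat d m)

/-- nonlinear remainder -/
def n (ε : ℝ) (u : (Fin d → ℝ) →ᵇ (Fin m → ℝ)) : (Fin d → ℝ) →ᵇ (Fin m → ℝ) :=
  D.G ε (nem D.f (0, D.S ε u) - D.L (D.S ε u))

/-- the full map -/
def Φ (ε : ℝ) (p : (Fin d → ℝ) × ((Fin d → ℝ) →ᵇ (Fin m → ℝ))) : (Fin d → ℝ) →ᵇ (Fin m → ℝ) :=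
  p.2 + D.G ε (nem D.f (p.1, D.S ε p.2) - lft (mcl D.A) (lft (mcl D.Γ⁻¹) p.2))

theorem Φ_zero (ε u) : D.Φ ε (0, u) = u + D.K ε u + D.n ε u := by
  unfold Φ n
  rw [K_apply, add_assoc, ← map_add]
  congr 2; abel

theorem n_zero (ε) : D.n ε 0 = D.G ε (nem D.f (0, 0)) := by
  simp [n]

theorem N_strict : HasStrictFDerivAt (fun v => nem D.f (0, v)) D.L 0 := by
  have h1 : HasStrictFDerivAt (nem D.f) (fderiv ℝ (nem D.f) (0, 0)) (0, 0) :=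
    (nem_analytic D.hf (0, 0)).hasStrictFDerivAt
  exact HasStrictFDerivAt.comp (f := fun v => ((0 : Fin d → ℝ), v)) 0 h1
    ((hasStrictFDerivAt_const (0 : Fin d → ℝ) _).prodMk (hasStrictFDerivAt_id _))

theorem n_lip : ∃ r κ : ℝ, 0 < r ∧ 0 ≤ κ ∧ (1 + D.CG * D.kk) * κ ≤ 1 / 4 ∧
    ∀ ε > 0, ∀ u ∈ Metric.closedBall 0 r, ∀ v ∈ Metric.closedBall 0 r,
      ‖D.n ε u - D.n ε v‖ ≤ κ * ‖u - v‖ := by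
  have hS := D.hCS
  have hG := D.hCG
  have hk := D.kk_nonneg
  set q := 1 + D.CG * D.kk with hq
  have hq1 : 1 ≤ q := by have := mul_nonneg hG hk; linarith
  set c : ℝ := 1 / (4 * q * (D.CG * D.CS + 1)) with hc
  have hc0 : 0 < c := by positivity
  have hN := D.N_strict.isLittleO.def hc0
  rw [Metric.eventually_nhds_iff] at hN
  obtain ⟨ρ, hρ, hN⟩ := hN
  refine ⟨ρ / (2 * (D.CS + 1)), D.CG * c * D.CS, by positivity, by positivity, ?_, ?_⟩
  · rw [hc]
    have : q * (D.CG * (1 / (4 * q * (D.CG * D.CS + 1))) * D.CS) =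
      (D.CG * D.CS) / (D.CG * D.CS + 1) * (1 / 4) := by field_simp
    rw [this]
    have : (D.CG * D.CS) / (D.CG * D.CS + 1) ≤ 1 := by
      rw [div_le_one (by positivity)]; linarith
    linarith
  · intro ε hε u hu v hv
    have key : ∀ w ∈ Metric.closedBall (0 : (Fin d → ℝ) →ᵇ (Fin m → ℝ)) (ρ / (2 * (D.CS + 1))),
        ‖D.S ε w‖ < ρ := by
      intro w hw
      rw [mem_closedBall_zero_iff] at hw
      calc _ ≤ _ := D.S1 ε hε w
        _ ≤ D.CS * (ρ / (2 * (D.CS + 1))) := by gcongr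
        _ = (D.CS / (D.CS + 1)) * (ρ / 2) := by field_simp
        _ ≤ 1 * (ρ / 2) := by
          gcongr
          rw [div_le_one (by positivity)]; linarith
        _ < ρ := by linarith
    have h1 := hN (y := (D.S ε u, D.S ε v)) (by
      rw [Prod.dist_eq]
      simp only [dist_zero_right]
      exact max_lt (key u hu) (key v hv))
    have h2 : ‖D.S ε u - D.S ε v‖ ≤ D.CS * ‖u - v‖ := by
      rw [← map_sub]; exact D.S1 ε hε _
    unfold n
    rw [← map_sub]
    refine (D.G1 ε hε _).trans ?_
    have e : nem D.f (0, D.S ε u) - D.L (D.S ε u) - (nem D.f (0, D.S ε v) - D.L (D.S ε v))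
      = nem D.f (0, D.S ε u) - nem D.f (0, D.S ε v) - D.L (D.S ε u - D.S ε v) := by
      rw [map_sub]; abel
    rw [e]
    calc _ ≤ D.CG * (c * (D.CS * ‖u - v‖)) := by
          refine mul_le_mul_of_nonneg_left (h1.trans ?_) hG
          exact mul_le_mul_of_nonneg_left h2 hc0.le
      _ = _ := by ring

theorem nem_tr (θ v) : nem D.f (θ, tr _ θ v) = tr _ θ (nem D.f (0, v)) := by
  ext1 ψ
  simp [nem_apply D.hf]

theorem nem_per (k) (v) : nem D.f (per k, v) = nem D.f (0, v) := by
  ext1 ψ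
  rw [nem_apply D.hf, nem_apply D.hf]
  simp [D.hf.per]

theorem Φ_tr (ε) (hε : 0 < ε) (θ u) : D.Φ ε (θ, tr _ θ u) = tr _ θ (D.Φ ε (0, u)) := by
  unfold Φ
  simp only
  rw [D.S2 ε hε, D.nem_tr, lft_tr, lft_tr, ← map_sub, D.G2 ε hε, map_add]

theorem Φ_per (ε k u) : D.Φ ε (per k, u) = D.Φ ε (0, u) := by
  unfold Φ
  simp only
  rw [D.nem_per]

theorem Φ_analytic (ε p) : AnalyticAt ℝ (D.Φ ε) p := by
  have h2 : AnalyticAt ℝ (fun p : (Fin d → ℝ) × ((Fin d → ℝ) →ᵇ (Fin m → ℝ)) => nem D.f (p.1, D.S ε p.2)) p := by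
    refine AnalyticAt.comp (g := nem D.f) (nem_analytic D.hf _) ?_
    exact analyticAt_fst.prod (((D.S ε).analyticAt _).comp analyticAt_snd)
  have h3 : AnalyticAt ℝ (fun p : (Fin d → ℝ) × ((Fin d → ℝ) →ᵇ (Fin m → ℝ)) =>
      lft (mcl D.A) (lft (mcl D.Γ⁻¹) p.2)) p :=
    (((lft (mcl D.A)).comp (lft (mcl D.Γ⁻¹))).analyticAt _).comp analyticAt_snd
  have h4 := ((D.G ε).analyticAt _).comp (h2.sub h3)
  exact analyticAt_snd.add h4

theorem sol_analytic (ε r κ) (hε : 0 < ε) (hK : ‖D.K ε * D.K ε‖ ≤ 1 / 4)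
    (hκ : (1 + ‖D.K ε‖) * κ ≤ 1 / 4) (hκ0 : 0 ≤ κ)
    (hn : ∀ u ∈ Metric.closedBall 0 r, ∀ v ∈ Metric.closedBall 0 r,
      ‖D.n ε u - D.n ε v‖ ≤ κ * ‖u - v‖) (u) (hu : ‖u‖ < r) (hu0 : D.Φ ε (0, u) = 0)
    (hper : ∀ k, tr _ (per k) u = u) :
    AnalyticOnNhd ℝ (D.S ε u) Set.univ := by
  have hΦ := D.Φ_analytic ε (0, u)
  have cdf : ContDiffAt ℝ ⊤ (D.Φ ε) (0, u) := hΦ.contDiffAt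
  have hder : HasFDerivAt (fun v => D.Φ ε (0, v))
      ((fderiv ℝ (D.Φ ε) (0, u)).comp (ContinuousLinearMap.inr ℝ _ _)) u :=
    HasFDerivAt.comp (f := fun v => ((0 : Fin d → ℝ), v)) u hΦ.differentiableAt.hasFDerivAt
      (hasFDerivAt_prodMk_right 0 u)
  set F' := (fderiv ℝ (D.Φ ε) (0, u)).comp (ContinuousLinearMap.inr ℝ (Fin d → ℝ) ((Fin d → ℝ) →ᵇ (Fin m → ℝ))) with hF'
  have hder2 : HasFDerivAt (D.n ε) (F' - (1 + D.K ε)) u := by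
    have := hder.sub ((1 + D.K ε).hasFDerivAt (x := u))
    refine this.congr_of_eventuallyEq (Eventually.of_forall fun v => ?_)
    simp [D.Φ_zero]
  have hbd : ‖F' - (1 + D.K ε)‖ ≤ κ := by
    refine hder2.le_of_lip' hκ0 ?_
    have : Metric.closedBall 0 r ∈ nhds u := by
      refine mem_of_superset (Metric.isOpen_ball.mem_nhds ?_) Metric.ball_subset_closedBall
      simpa using hu
    filter_upwards [this] with v hv
    exact hn v hv u (by simpa using hu.le)
  have hunit := isUnit_near (D.K ε) F' hK κ hbd hκ
  have hinv : F'.IsInvertible := by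
    obtain ⟨U, hU⟩ := hunit
    exact ⟨ContinuousLinearEquiv.ofUnit U, by rw [← hU]; rfl⟩
  have hne : (⊤ : WithTop ℕ∞) ≠ 0 := by simp
  have hev := cdf.eventually_apply_eq_iff_implicitFunction hne hinv
  have hphi := (cdf.contDiffAt_implicitFunction hne hinv).analyticAt
  set φ := cdf.implicitFunction hne hinv with hφ
  have htend : Tendsto (fun θ => (θ, tr _ θ u)) (nhds 0) (nhds ((0 : Fin d → ℝ), u)) := by
    rw [nhds_prod_eq]
    exact tendsto_id.prodMk (tr_tendsto u hper)
  have hEq : ∀ᶠ θ in nhds (0 : Fin d → ℝ), φ θ = tr _ θ u := by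
    filter_upwards [htend.eventually hev] with θ hθ
    refine hθ.1 ?_
    rw [D.Φ_tr ε hε, hu0, map_zero]
  intro ψ _
  have h1 : AnalyticAt ℝ (fun θ => (D.S ε (φ θ)) ψ) 0 :=
    (((BoundedContinuousFunction.evalCLM ℝ ψ).comp (D.S ε)).analyticAt _).comp hphi
  have h2 : AnalyticAt ℝ (fun θ => (D.S ε u) (ψ + θ)) 0 := by
    refine h1.congr ?_
    filter_upwards [hEq] with θ hθ
    rw [hθ, D.S2 ε hε]; rfl
  have h3 : AnalyticAt ℝ (fun χ : Fin d → ℝ => χ - ψ) ψ := analyticAt_id.sub analyticAt_const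
  have h4 := AnalyticAt.fun_comp (g := fun θ => (D.S ε u) (ψ + θ)) (f := fun χ : Fin d → ℝ => χ - ψ)
    (x := ψ) (by simpa using h2) h3
  simpa [Function.comp_def] using h4

theorem sol_ode (ε) (hε : 0 < ε) (u) (hu0 : D.Φ ε (0, u) = 0) :
    ∃ x' : ℝ → (Fin m → ℝ), (∀ t, HasDerivAt (fun t : ℝ => D.S ε u (t • D.ω)) (x' t) t) ∧
      ∀ t, ∃ x'', HasDerivAt x' x'' t ∧
        ε • D.M.mulVec x'' + D.Γ.mulVec (x' t) + ε • D.f (D.S ε u (t • D.ω), t • D.ω) = 0 := by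
  have hdet : IsUnit D.M.det := D.hM.det_pos.ne'.isUnit
  have hS3 := D.S3 ε hε u 0
  simp only [zero_add] at hS3
  choose x' hx' hx2 using hS3
  refine ⟨x', hx', fun t => ?_⟩
  have hε0 := hε.ne'
  have ex : x' = fun t => ε⁻¹ • D.M⁻¹.mulVec (u (t • D.ω) - D.Γ.mulVec (D.S ε u (t • D.ω))) := by
    funext t
    rw [← hx2 t, add_sub_cancel_left, Matrix.mulVec_smul, smul_smul, inv_mul_cancel₀ hε0, one_smul,
      Matrix.mulVec_mulVec, Matrix.nonsing_inv_mul _ hdet, Matrix.one_mulVec]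
  -- derivative of u
  set w := nem D.f (0, D.S ε u) - lft (mcl D.A) (lft (mcl D.Γ⁻¹) u) with hw
  have huw : u = - D.G ε w := eq_neg_of_add_eq_zero_left hu0
  have hG3 := (D.G3 ε hε w 0 t).neg
  simp only [zero_add] at hG3
  have hud : HasDerivAt (fun t : ℝ => u (t • D.ω)) (-(ε • D.f (D.S ε u (t • D.ω), t • D.ω))) t := by
    have e1 : (fun t : ℝ => u (t • D.ω)) = fun t => - (D.G ε w (t • D.ω)) := by
      funext s; conv_lhs => rw [huw]
      rfl
    rw [e1]
    have e2 : D.G ε w (t • D.ω) = - u (t • D.ω) := by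
      conv_rhs => rw [huw]
      simp
    have e3 : ε • D.f (D.S ε u (t • D.ω), t • D.ω) =
        ε • (w (t • D.ω) - D.A.mulVec (D.Γ⁻¹.mulVec (D.G ε w (t • D.ω)))) := by
      rw [e2, hw]
      simp [nem_apply D.hf, mcl_apply, Matrix.mulVec_neg]
    rw [e3]
    exact hG3
  have hd := (hud.sub ((mcl D.Γ).hasFDerivAt.comp_hasDerivAt t (hx' t)))
  have hd2 := ((mcl D.M⁻¹).hasFDerivAt.comp_hasDerivAt t hd).const_smul ε⁻¹
  refine ⟨ε⁻¹ • (mcl D.M⁻¹) (-(ε • D.f (D.S ε u (t • D.ω), t • D.ω)) - mcl D.Γ (x' t)), ?_, ?_⟩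
  · refine hd2.congr_of_eventuallyEq (Eventually.of_forall fun s => ?_)
    rw [ex]; rfl
  · simp only [mcl_apply]
    rw [Matrix.mulVec_smul, smul_smul, mul_inv_cancel₀ hε0, one_smul,
      Matrix.mulVec_mulVec, Matrix.mul_nonsing_inv _ hdet, Matrix.one_mulVec]
    abel

theorem solution : ∃ ε₀ > (0 : ℝ), ∃ X : ℝ → (Fin d → ℝ) → (Fin m → ℝ),
    (∀ ε ∈ Set.Ioo (0 : ℝ) ε₀,
      AnalyticOnNhd ℝ (X ε) Set.univ ∧ (∀ ψ k, X ε (ψ + per k) = X ε ψ) ∧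
      ∃ x' : ℝ → (Fin m → ℝ), (∀ t, HasDerivAt (fun t : ℝ => X ε (t • D.ω)) (x' t) t) ∧
      ∀ t, ∃ x'', HasDerivAt x' x'' t ∧
        ε • D.M.mulVec x'' + D.Γ.mulVec (x' t) + ε • D.f (X ε (t • D.ω), t • D.ω) = 0) ∧
      Tendsto (fun ε : ℝ => ⨆ ψ : Fin d → ℝ, ‖X ε ψ‖)
        (nhdsWithin 0 (Set.Ioi 0)) (nhds 0) := by
  have hS := D.hCS
  have hG := D.hCG
  have hk := D.kk_nonneg
  obtain ⟨r, κ, hr, hκ0, hκ, hn⟩ := D.n_lip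
  set q := 1 + D.CG * D.kk with hq
  have hq1 : 1 ≤ q := by have := mul_nonneg hG hk; linarith
  obtain ⟨δ1, hδ1, h1⟩ := D.small1 (r / (8 * q)) (by positivity)
  obtain ⟨δ2, hδ2, h2⟩ := D.small2 (1 / 4) (by norm_num)
  have hKq : ∀ ε > 0, 1 + ‖D.K ε‖ ≤ q := fun ε hε => by
    have := D.K_norm ε hε; rw [hq]; linarith
  have hex : ∀ ε, ∃ u : (Fin d → ℝ) →ᵇ (Fin m → ℝ), 0 < ε → ε < min δ1 δ2 →
      ‖u‖ ≤ 2 * ((1 + ‖D.K ε‖) * ‖D.n ε 0‖) ∧ u + D.K ε u + D.n ε u = 0 := by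
    intro ε
    by_cases hε : 0 < ε ∧ ε < min δ1 δ2
    · obtain ⟨u, hu⟩ := fix_exists (D.K ε) (h2 ε hε.1 (hε.2.trans_le (min_le_right _ _)))
        (D.n ε) r κ hr.le (hn ε hε.1)
        ((mul_le_mul_of_nonneg_right (hKq ε hε.1) hκ0).trans hκ) (by
          rw [D.n_zero]
          calc _ ≤ q * (r / (8 * q)) :=
                mul_le_mul (hKq ε hε.1) (h1 ε hε.1 (hε.2.trans_le (min_le_left _ _)))
                  (norm_nonneg _) (by linarith)
            _ = r / 8 := by field_simp
            _ ≤ r / 2 := by linarith)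
      exact ⟨u, fun _ _ => hu⟩
    · exact ⟨0, fun a b => (hε ⟨a, b⟩).elim⟩
  choose u hu using hex
  have hub : ∀ ε, 0 < ε → ε < min δ1 δ2 → ‖u ε‖ ≤ 2 * (q * ‖D.G ε (nem D.f (0, 0))‖) := by
    intro ε hε hε'
    refine (hu ε hε hε').1.trans ?_
    rw [D.n_zero]
    have := hKq ε hε
    gcongr
  refine ⟨min δ1 δ2, by positivity, fun ε => D.S ε (u ε), ?_, ?_⟩
  · rintro ε ⟨hε, hε'⟩
    have hK := h2 ε hε (hε'.trans_le (min_le_right _ _))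
    have hκ' := (mul_le_mul_of_nonneg_right (hKq ε hε) hκ0).trans hκ
    have hur : ‖u ε‖ < r := by
      calc _ ≤ _ := hub ε hε hε'
        _ ≤ 2 * (q * (r / (8 * q))) := by
          have := h1 ε hε (hε'.trans_le (min_le_left _ _))
          gcongr
        _ = r / 4 := by field_simp; norm_num
        _ < r := by linarith
    have h0 : D.Φ ε (0, u ε) = 0 := by rw [D.Φ_zero]; exact (hu ε hε hε').2
    have hper : ∀ k, tr _ (per k) (u ε) = u ε := by
      intro k
      refine fix_unique (D.K ε) hK (D.n ε) r κ (hn ε hε) hκ' _ _ ?_ ?_ ?_ ?_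
      · simpa using (tr_norm_le (per k) (u ε)).trans hur.le
      · simpa using hur.le
      · rw [← D.Φ_zero, ← D.Φ_per ε k, D.Φ_tr ε hε, h0, map_zero]
      · exact (hu ε hε hε').2
    refine ⟨D.sol_analytic ε r κ hε hK hκ' hκ0 (hn ε hε) _ hur h0 hper, fun ψ k => ?_,
      D.sol_ode ε hε _ h0⟩
    have := D.S2 ε hε (per k) (u ε)
    rw [hper] at this
    exact (DFunLike.congr_fun this ψ).symm
  · rw [Metric.tendsto_nhdsWithin_nhds]
    intro η hη
    obtain ⟨δ3, hδ3, h3⟩ := D.small1 (η / (4 * q * (D.CS + 1))) (by positivity)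
    refine ⟨min (min δ1 δ2) δ3, by positivity, fun {ε} hε hε' => ?_⟩
    replace hε : 0 < ε := hε
    rw [Real.dist_eq, sub_zero, abs_of_pos hε] at hε'
    have e : (⨆ ψ : Fin d → ℝ, ‖D.S ε (u ε) ψ‖) = ‖D.S ε (u ε)‖ :=
      (BoundedContinuousFunction.norm_eq_iSup_norm _).symm
    simp only [e]
    rw [dist_zero_right, norm_norm]
    have h4 := hub ε hε (hε'.trans_le (min_le_left _ _))
    have h5 := h3 ε hε (hε'.trans_le (min_le_right _ _))
    calc _ ≤ D.CS * ‖u ε‖ := D.S1 ε hε _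
      _ ≤ D.CS * (2 * (q * (η / (4 * q * (D.CS + 1))))) := by
        gcongr
        exact h4.trans (by gcongr)
      _ = (D.CS / (D.CS + 1)) * (η / 2) := by field_simp; norm_num
      _ ≤ 1 * (η / 2) := by
        gcongr
        rw [div_le_one (by positivity)]; linarith
      _ < η := by linarith

end Dat

end Part9

section Part10

open BoundedContinuousFunction MeasureTheory
theorem exists_dat (m d : ℕ)
    (ω : Fin d → ℝ) (hω : ∀ ν : Fin d → ℤ, ν ≠ 0 → (∑ j, ω j * ν j) ≠ 0)
    (M Γ A : Matrix (Fin m) (Fin m) ℝ) (hM : M.PosDef) (hΓ : Γ.PosDef) (hA : A.PosDef)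
    (f : (Fin m → ℝ) × (Fin d → ℝ) → (Fin m → ℝ)) (hf : AnPer f)
    (h0 : ∀ i, mean d (lft (ContinuousLinearMap.proj i) (nem f (0, 0))) = 0)
    (h1 : ∀ i j, mean d (lft (ContinuousLinearMap.proj j)
      (nem (fun z => fderiv ℝ f z (Pi.single i 1, 0)) (0, 0))) = A i j) :
    ∃ D : Dat d m, D.ω = ω ∧ D.M = M ∧ D.Γ = Γ ∧ D.f = f := by
  obtain ⟨CS, hCS, S, HS⟩ := exists_S ω M Γ hM hΓ
  obtain ⟨CG, hCG, G, HG⟩ := exists_G ω A Γ hA hΓ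
  have hsymm : ∀ i j, A j i = A i j := fun i j => by
    have := hA.isHermitian.apply i j
    simpa using this
  have nper : ∀ {g : (Fin m → ℝ) × (Fin d → ℝ) → (Fin m → ℝ)}, AnPer g → ∀ ψ k,
      nem g (0, 0) (ψ + per k) = nem g (0, 0) ψ := by
    intro g hg ψ k
    rw [nem_apply hg, nem_apply hg]
    simp [hg.per]
  refine ⟨⟨ω, M, Γ, A, hM, f, hf, ?_, ?_, CS, hCS, S, fun ε hε => (HS ε hε).1,
    fun ε hε => (HS ε hε).2.1, fun ε hε => (HS ε hε).2.2.1, fun ε hε => (HS ε hε).2.2.2,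
    CG, hCG, G, fun ε hε => (HG ε hε).1, fun ε hε => (HG ε hε).2.1,
    fun ε hε => (HG ε hε).2.2.1, fun ε hε => (HG ε hε).2.2.2⟩, rfl, rfl, rfl, rfl⟩
  · intro i
    refine mem_cob ω hω _ (fun ψ k => ?_) (h0 i)
    simp only [ContinuousLinearMap.compLeftContinuousBounded_apply]
    rw [nper hf]
  · intro i j
    refine mem_cob ω hω _ (fun ψ k => ?_) ?_
    · simp only [BoundedContinuousFunction.sub_apply, constL_apply,
        ContinuousLinearMap.compLeftContinuousBounded_apply]
      rw [nper (hf.dir _)]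
    · rw [map_sub, h1, mean_const, hsymm, sub_self]

theorem main_aux
    (m d : ℕ)
    (ω : Fin d → ℝ) (hω : ∀ ν : Fin d → ℤ, ν ≠ 0 → (∑ j, ω j * ν j) ≠ 0)
    (M Γ : Matrix (Fin m) (Fin m) ℝ)
    (hMpos : M.PosDef) (hΓpos : Γ.PosDef)
    (Vt : (Fin m → ℝ) × (Fin d → ℝ) → ℝ) (hVt : AnalyticOnNhd ℝ Vt Set.univ)
    (hVtper : ∀ (x : Fin m → ℝ) (ψ : Fin d → ℝ) (k : Fin d → ℤ),
      Vt (x, fun j => ψ j + 2 * π * k j) = Vt (x, ψ))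
    (h : (Fin m → ℝ) → (Fin d → ℝ) → (Fin m → ℝ))
    (hh : ∀ x ψ i, h x ψ i = fderiv ℝ (fun y => Vt (y, ψ)) x (Pi.single i 1))
    (Vt₀ : (Fin m → ℝ) → ℝ)
    (hVt₀ : ∀ x, Vt₀ x =
      ((2 * π)⁻¹ ^ d) *
        ∫ ψ in Set.univ.pi fun _ : Fin d => Set.Icc (0 : ℝ) (2 * π), Vt (x, ψ))
    (c : Fin m → ℝ)
    (hcrit : ∀ i, fderiv ℝ Vt₀ c (Pi.single i 1) = 0)
    (hhess : (hessianMatrix m Vt₀ c).PosDef) :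
    ∃ ε₀ > (0 : ℝ), ∃ X : ℝ → (Fin d → ℝ) → (Fin m → ℝ),
      (∀ ε ∈ Set.Ioo (0 : ℝ) ε₀,
        AnalyticOnNhd ℝ (X ε) Set.univ ∧ IsPeriodic2pi d m (X ε) ∧
        ∀ t : ℝ,
          ε • M.mulVec (deriv (deriv fun s : ℝ => c + X ε fun j => ω j * s) t)
            + Γ.mulVec (deriv (fun s : ℝ => c + X ε fun j => ω j * s) t)
            + ε • h (c + X ε fun j => ω j * t) (fun j => ω j * t)
          = 0) ∧
      Tendsto (fun ε : ℝ => ⨆ ψ : Fin d → ℝ, ‖X ε ψ‖)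
        (nhdsWithin 0 (Set.Ioi 0)) (nhds 0) := by
  obtain ⟨f, hfh, hf, h0, h1⟩ := setup Vt hVt hVtper h hh Vt₀ hVt₀ c hcrit
  obtain ⟨D, rfl, rfl, rfl, rfl⟩ := exists_dat m d ω hω M Γ _ hMpos hΓpos hhess f hf h0 h1
  obtain ⟨ε₀, hε₀, X, hX, hlim⟩ := D.solution
  refine ⟨ε₀, hε₀, X, fun ε hε => ?_, hlim⟩
  obtain ⟨h2, h3, x', hx', h4⟩ := hX ε hε
  refine ⟨h2, fun ψ k => h3 ψ k, fun t => ?_⟩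
  have e : ∀ s : ℝ, (fun j => D.ω j * s) = s • D.ω := fun s => by
    funext j; simp [mul_comm]
  simp only [e]
  have e2 : (deriv fun s : ℝ => c + X ε (s • D.ω)) = x' :=
    funext fun s => ((hx' s).const_add c).deriv
  obtain ⟨x'', h5, h6⟩ := h4 t
  rw [e2, h5.deriv, ← hfh (X ε (t • D.ω), t • D.ω)]
  exact h6

end Part10

theorem forced_quasiperiodic_response_solution_general
    (m d : ℕ) (hm : 1 ≤ m) (hd : 1 ≤ d)
    (ω : Fin d → ℝ) (hω : ∀ ν : Fin d → ℤ, ν ≠ 0 → (∑ j, ω j * ν j) ≠ 0)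
    (M Γ : Matrix (Fin m) (Fin m) ℝ)
    (hMsymm : M.IsSymm) (hMpos : M.PosDef)
    (hΓsymm : Γ.IsSymm) (hΓpos : Γ.PosDef)
    (Vt : (Fin m → ℝ) × (Fin d → ℝ) → ℝ) (hVt : AnalyticOnNhd ℝ Vt Set.univ)
    (hVtper : ∀ (x : Fin m → ℝ) (ψ : Fin d → ℝ) (k : Fin d → ℤ),
      Vt (x, fun j => ψ j + 2 * π * k j) = Vt (x, ψ))
    (h : (Fin m → ℝ) → (Fin d → ℝ) → (Fin m → ℝ))
    (hh : ∀ x ψ i, h x ψ i = fderiv ℝ (fun y => Vt (y, ψ)) x (Pi.single i 1))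
    (Vt₀ : (Fin m → ℝ) → ℝ)
    (hVt₀ : ∀ x, Vt₀ x =
      ((2 * π)⁻¹ ^ d) *
        ∫ ψ in Set.univ.pi fun _ : Fin d => Set.Icc (0 : ℝ) (2 * π), Vt (x, ψ))
    (c : Fin m → ℝ)
    (hcrit : ∀ i, fderiv ℝ Vt₀ c (Pi.single i 1) = 0)
    (hhess : (hessianMatrix m Vt₀ c).PosDef) :
    ∃ ε₀ > (0 : ℝ), ∃ X : ℝ → (Fin d → ℝ) → (Fin m → ℝ),
      (∀ ε ∈ Set.Ioo (0 : ℝ) ε₀,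
        AnalyticOnNhd ℝ (X ε) Set.univ ∧ IsPeriodic2pi d m (X ε) ∧
        ∀ t : ℝ,
          ε • M.mulVec (deriv (deriv fun s : ℝ => c + X ε fun j => ω j * s) t)
            + Γ.mulVec (deriv (fun s : ℝ => c + X ε fun j => ω j * s) t)
            + ε • h (c + X ε fun j => ω j * t) (fun j => ω j * t)
          = 0) ∧
      Tendsto (fun ε : ℝ => ⨆ ψ : Fin d → ℝ, ‖X ε ψ‖)
        (nhdsWithin 0 (Set.Ioi 0)) (nhds 0) := by
  exact main_aux m d ω hω M Γ hMpos hΓpos Vt hVt hVtper h hh Vt₀ hVt₀ c hcrit hhess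

end
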